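/- arXiv:2508.17100 — 11 statements merged into one kernel-verified Lean document; each statement's English description precedes it below -/
import Mathlib

section
/- Let R be a (not necessarily commutative) Bézout ring of stable range 1. Then for every 2×2 matrix A over R there exist elements z, γ, d ∈ R such that A is equivalent to the matrix [[z, γ], [d, 0]] and RzR = A_*. -/
open Matrix

section Defs

variable {R : Type*} [Ring R]

/-- The two-sided ideal `A_*` generated by the entries of a matrix (the "coboundary"). -/
def matStar {m n : ℕ} (A : Matrix (Fin m) (Fin n) R) : TwoSidedIdeal R :=
  TwoSidedIdeal.span {x : R | ∃ i j, A i j = x}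

/-- Two matrices are equivalent if `A = P * B * Q` for invertible `P`, `Q`. -/
def MatEquiv {m n : ℕ} (A B : Matrix (Fin m) (Fin n) R) : Prop :=
  ∃ (P : Matrix (Fin m) (Fin m) R) (Q : Matrix (Fin n) (Fin n) R),
    IsUnit P ∧ IsUnit Q ∧ A = P * B * Q

/-- A nonzero element `a` is duo if `aR = Ra`. -/
def IsDuoElem (a : R) : Prop :=
  a ≠ 0 ∧ ∀ x : R, (∃ r, x = a * r) ↔ ∃ s, x = s * a

/-- Dubrovin's property: for each `a` the two-sided ideal `RaR` is principal
as a right ideal and as a left ideal, with a common generator. -/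
def DProp (R : Type*) [Ring R] : Prop :=
  ∀ a : R, ∃ b : R,
    (∀ x : R, x ∈ TwoSidedIdeal.span {a} ↔ ∃ r, x = b * r) ∧
    (∀ x : R, (∃ r, x = b * r) ↔ ∃ s, x = s * b)

/-- Komarnytsky's property: every factor of a duo element is a duo element. -/
def KProp (R : Type*) [Ring R] : Prop :=
  ∀ a z : R, IsDuoElem a → (∃ u v, a = u * z * v) → IsDuoElem z

/-- Dubrovin–Komarnytsky property. -/
def DKProp (R : Type*) [Ring R] : Prop := DProp R ∧ KProp R

/-- A (possibly rectangular) matrix is of the form `diag(d₁, …, d_k, 0, …, 0)`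
with `R d_{i+1} R ⊆ d_i R ∩ R d_i` for consecutive diagonal entries. -/
def IsTotalDivisorDiag {m n : ℕ} (D : Matrix (Fin m) (Fin n) R) : Prop :=
  (∀ (i : Fin m) (j : Fin n), (i : ℕ) ≠ (j : ℕ) → D i j = 0) ∧
  (∀ (i : Fin m) (j : Fin n) (i' : Fin m) (j' : Fin n),
    (i : ℕ) = (j : ℕ) → (i' : ℕ) = (j' : ℕ) → (i' : ℕ) = (i : ℕ) + 1 →
    ∀ x ∈ TwoSidedIdeal.span {D i' j'},
      (∃ r, x = D i j * r) ∧ (∃ s, x = s * D i j))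

/-- Elementary divisor ring. -/
def IsEDRing (R : Type*) [Ring R] : Prop :=
  ∀ (m n : ℕ) (A : Matrix (Fin m) (Fin n) R),
    ∃ (P : Matrix (Fin m) (Fin m) R) (Q : Matrix (Fin n) (Fin n) R),
      IsUnit P ∧ IsUnit Q ∧ IsTotalDivisorDiag (P * A * Q)

/-- Diagonal reduction of the `EDK` type: additionally every diagonal entry with a
nonzero diagonal successor (i.e. each of `ε₁, …, ε_{k-1}`) is a duo element. -/
def IsEDKDiag {m n : ℕ} (D : Matrix (Fin m) (Fin n) R) : Prop :=
  IsTotalDivisorDiag D ∧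
  (∀ (i : Fin m) (j : Fin n) (i' : Fin m) (j' : Fin n),
    (i : ℕ) = (j : ℕ) → (i' : ℕ) = (j' : ℕ) → (i' : ℕ) = (i : ℕ) + 1 →
    D i' j' ≠ 0 → IsDuoElem (D i j))

/-- Elementary Dubrovin–Komarnytsky property. -/
def EDKProp (R : Type*) [Ring R] : Prop :=
  ∀ (m n : ℕ) (A : Matrix (Fin m) (Fin n) R),
    ∃ (P : Matrix (Fin m) (Fin m) R) (Q : Matrix (Fin n) (Fin n) R),
      IsUnit P ∧ IsUnit Q ∧ IsEDKDiag (P * A * Q)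

/-- Bézout ring: every finitely generated right ideal and every finitely
generated left ideal is principal. -/
def IsBezoutRing (R : Type*) [Ring R] : Prop :=
  (∀ I : Ideal Rᵐᵒᵖ, I.FG → ∃ d, I = Ideal.span {d}) ∧
  (∀ I : Ideal R, I.FG → ∃ d, I = Ideal.span {d})

/-- Stable range `1`: `aR + bR = R` implies `(a + bt)R = R` for some `t`. -/
def StableRangeOne (R : Type*) [Ring R] : Prop :=
  ∀ a b : R, (∃ x y, a * x + b * y = 1) → ∃ t u, (a + b * t) * u = 1

/-- Right Hermite ring: every `1 × 2` matrix admits a diagonal reduction. -/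
def IsRightHermite (R : Type*) [Ring R] : Prop :=
  ∀ a b : R, ∃ (P : Matrix (Fin 2) (Fin 2) R) (c : R),
    IsUnit P ∧ Matrix.of ![![a, b]] * P = Matrix.of ![![c, 0]]

/-- Left Hermite ring: every `2 × 1` matrix admits a diagonal reduction. -/
def IsLeftHermite (R : Type*) [Ring R] : Prop :=
  ∀ a b : R, ∃ (Q : Matrix (Fin 2) (Fin 2) R) (d : R),
    IsUnit Q ∧ Q * Matrix.of ![![a], ![b]] = Matrix.of ![![d], ![0]]

/-- Hermite ring. -/
def IsHermiteRing (R : Type*) [Ring R] : Prop := IsRightHermite R ∧ IsLeftHermite R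

/-- Quasi-duo: every maximal right ideal and every maximal left ideal is two-sided. -/
def QuasiDuo (R : Type*) [Ring R] : Prop :=
  (∀ I : Ideal R, I.IsMaximal → ∀ x ∈ I, ∀ r : R, x * r ∈ I) ∧
  (∀ I : Ideal Rᵐᵒᵖ, I.IsMaximal → ∀ x ∈ I, ∀ r : Rᵐᵒᵖ, x * r ∈ I)

/-- `a` is 2-simple: `u₁av₁ + u₂av₂ = 1` for some `uᵢ, vᵢ`, and `n = 2` is minimal. -/
def TwoSimple (a : R) : Prop :=
  (∃ u₁ v₁ u₂ v₂ : R, u₁ * a * v₁ + u₂ * a * v₂ = 1) ∧ ¬ ∃ u v : R, u * a * v = 1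

/-- A nonzero element is finite if every right ideal and every left ideal
containing it is principal. -/
def FiniteElem (a : R) : Prop :=
  a ≠ 0 ∧
  (∀ I : Ideal Rᵐᵒᵖ, MulOpposite.op a ∈ I → ∃ d, I = Ideal.span {d}) ∧
  (∀ I : Ideal R, a ∈ I → ∃ d, I = Ideal.span {d})

end Defs

theorem IsBezoutRing.exists_right_gcd {R : Type*} [Ring R] (hB : IsBezoutRing R) (a b : R) :
    ∃ d x y a' b' : R, d = a * x + b * y ∧ a = d * a' ∧ b = d * b' := by
  obtain ⟨d, hd⟩ := hB.1 (Ideal.span {MulOpposite.op a, MulOpposite.op b})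
    (Submodule.fg_span (Set.toFinite _))
  have ha : MulOpposite.op a ∈ Ideal.span {d} := hd ▸ Ideal.subset_span (by simp)
  have hb : MulOpposite.op b ∈ Ideal.span {d} := hd ▸ Ideal.subset_span (by simp)
  have hd' : d ∈ Ideal.span {MulOpposite.op a, MulOpposite.op b} :=
    hd ▸ Ideal.mem_span_singleton_self d
  obtain ⟨a', ha'⟩ := Ideal.mem_span_singleton'.1 ha
  obtain ⟨b', hb'⟩ := Ideal.mem_span_singleton'.1 hb
  obtain ⟨x, y, hxy⟩ := Ideal.mem_span_pair.1 hd'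
  refine ⟨d.unop, x.unop, y.unop, a'.unop, b'.unop, ?_, ?_, ?_⟩
  · rw [← hxy]; simp
  · simpa using (congrArg MulOpposite.unop ha').symm
  · simpa using (congrArg MulOpposite.unop hb').symm

theorem IsBezoutRing.exists_left_gcd {R : Type*} [Ring R] (hB : IsBezoutRing R) (a b : R) :
    ∃ d x y a' b' : R, d = x * a + y * b ∧ a = a' * d ∧ b = b' * d := by
  obtain ⟨d, hd⟩ := hB.2 (Ideal.span {a, b}) (Submodule.fg_span (Set.toFinite _))
  have ha : a ∈ Ideal.span {d} := hd ▸ Ideal.subset_span (by simp)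
  have hb : b ∈ Ideal.span {d} := hd ▸ Ideal.subset_span (by simp)
  have hd' : d ∈ Ideal.span {a, b} := hd ▸ Ideal.mem_span_singleton_self d
  obtain ⟨a', ha'⟩ := Ideal.mem_span_singleton'.1 ha
  obtain ⟨b', hb'⟩ := Ideal.mem_span_singleton'.1 hb
  obtain ⟨x, y, hxy⟩ := Ideal.mem_span_pair.1 hd'
  exact ⟨d, x, y, a', b', hxy.symm, ha'.symm, hb'.symm⟩

/-- Left-handed form of stable range one, for a pair `a`, `1 - x * a`. -/
theorem StableRangeOne.exists_left_inverse {R : Type*} [Ring R] (hS : StableRangeOne R)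
    (a x : R) : ∃ t u : R, u * (a + t * (1 - x * a)) = 1 := by
  obtain ⟨s, w, hw⟩ := hS x (1 - x * a) ⟨a, 1, by noncomm_ring⟩
  have h₁ : x * (a + (1 - a * s) * w * (1 - x * a)) = 1 - s * w * (1 - x * a) := by
    calc _ = x * a + ((x + (1 - x * a) * s) * w) * (1 - x * a) - s * w * (1 - x * a) := by
          noncomm_ring
      _ = _ := by rw [hw]; noncomm_ring
  refine ⟨(1 - a * s) * w, x + s * (1 - a * x), ?_⟩
  generalize hv : a + (1 - a * s) * w * (1 - x * a) = v at h₁ ⊢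
  calc (x + s * (1 - a * x)) * v = x * v + s * v - s * a * (x * v) := by noncomm_ring
    _ = 1 := by rw [h₁, ← hv]; noncomm_ring

theorem exists_right_generator_add_mul {R : Type*} [Ring R] (hB : IsBezoutRing R)
    (hS : StableRangeOne R) (a b : R) :
    ∃ s p q : R, a = (a + b * s) * p ∧ b = (a + b * s) * q := by
  obtain ⟨d, x, y, a', b', hd, ha, hb⟩ := hB.exists_right_gcd a b
  obtain ⟨t, u, hu⟩ := hS a' (1 - a' * x) ⟨x, 1, by noncomm_ring⟩
  have hdc : d * (1 - a' * x) = b * y := by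
    rw [mul_sub, mul_one, ← mul_assoc, ← ha]; nth_rw 1 [hd]; abel
  have hdu : d = (a + b * (y * t)) * u := by
    calc d = d * ((a' + (1 - a' * x) * t) * u) := by rw [hu, mul_one]
      _ = (d * a' + d * (1 - a' * x) * t) * u := by noncomm_ring
      _ = _ := by rw [hdc, ← ha]; noncomm_ring
  exact ⟨y * t, u * a', u * b', by rw [← mul_assoc, ← hdu, ← ha],
    by rw [← mul_assoc, ← hdu, ← hb]⟩

theorem exists_left_generator_add_mul {R : Type*} [Ring R] (hB : IsBezoutRing R)
    (hS : StableRangeOne R) (a b : R) :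
    ∃ t p q : R, a = p * (a + t * b) ∧ b = q * (a + t * b) := by
  obtain ⟨d, x, y, a', b', hd, ha, hb⟩ := hB.exists_left_gcd a b
  obtain ⟨t, u, hu⟩ := hS.exists_left_inverse a' x
  have hdc : (1 - x * a') * d = y * b := by
    rw [sub_mul, one_mul, mul_assoc, ← ha]; nth_rw 1 [hd]; abel
  have hdu : d = u * (a + t * y * b) := by
    calc d = u * (a' + t * (1 - x * a')) * d := by rw [hu, one_mul]
      _ = u * (a' * d + t * ((1 - x * a') * d)) := by noncomm_ring
      _ = _ := by rw [hdc, ← ha]; noncomm_ring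
  exact ⟨t * y, a' * u, b' * u, by rw [mul_assoc, ← hdu, ← ha],
    by rw [mul_assoc, ← hdu, ← hb]⟩

theorem isUnit_upper_unitriangular {R : Type*} [Ring R] (r : R) :
    IsUnit (!![1, r; 0, 1] : Matrix (Fin 2) (Fin 2) R) :=
  ⟨⟨!![1, r; 0, 1], !![1, -r; 0, 1], by simp [Matrix.one_fin_two], by simp [Matrix.one_fin_two]⟩,
    rfl⟩

theorem isUnit_lower_unitriangular {R : Type*} [Ring R] (r : R) :
    IsUnit (!![1, 0; r, 1] : Matrix (Fin 2) (Fin 2) R) :=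
  ⟨⟨!![1, 0; r, 1], !![1, 0; -r, 1], by simp [Matrix.one_fin_two], by simp [Matrix.one_fin_two]⟩,
    rfl⟩

/-- Over a Bézout ring of stable range 1, every `2 × 2` matrix `A` is
equivalent to `[[z, γ], [d, 0]]` with `RzR = A_*`. -/
theorem stmt0 {R : Type*} [Ring R] [Nontrivial R]
    (hB : IsBezoutRing R) (hS : StableRangeOne R)
    (A : Matrix (Fin 2) (Fin 2) R) :
    ∃ z γ d : R,
      MatEquiv A (Matrix.of ![![z, γ], ![d, 0]]) ∧
      TwoSidedIdeal.span {z} = matStar A := by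
  obtain ⟨s, p, q, hp, hq⟩ := exists_right_generator_add_mul hB hS (A 1 0) (A 1 1)
  set d := A 1 0 + A 1 1 * s with hd
  set x := A 0 0 + A 0 1 * s with hx
  set y := A 0 1 - x * q with hy
  obtain ⟨t, p₁, q₁, hp₁, hq₁⟩ := exists_left_generator_add_mul hB hS x d
  set w := x + t * d with hw
  obtain ⟨r, p₂, q₂, hp₂, hq₂⟩ := exists_right_generator_add_mul hB hS w y
  set z := w + y * r with hz
  have h00 : A 0 0 = x - A 0 1 * s := by rw [hx]; abel
  have h01 : A 0 1 = y + x * q := by rw [hy]; abel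
  have h10 : A 1 0 = d - A 1 1 * s := by rw [hd]; abel
  refine ⟨z, y, d, ⟨!![1, -t; 0, 1], !![1, 0; -r, 1] * !![1, q; 0, 1] * !![1, 0; -s, 1],
    isUnit_upper_unitriangular _, ((isUnit_lower_unitriangular _).mul
      (isUnit_upper_unitriangular _)).mul (isUnit_lower_unitriangular _), ?_⟩, ?_⟩
  · have hA : A = !![x - (y + x * q) * s, y + x * q; d - d * q * s, d * q] := by
      rw [← h01, ← hq, ← h00, ← h10]
      exact Matrix.eta_fin_two A
    rw [hA, hz, hw]
    clear_value d x y
    ext i j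
    fin_cases i <;> fin_cases j <;> simp [Matrix.mul_apply, Fin.sum_univ_two] <;> noncomm_ring
  · apply le_antisymm
    · have hA (i j) : A i j ∈ matStar A := TwoSidedIdeal.subset_span ⟨i, j, rfl⟩
      have hxm : x ∈ matStar A :=
        (matStar A).add_mem (hA 0 0) ((matStar A).mul_mem_right _ _ (hA 0 1))
      have hdm : d ∈ matStar A :=
        (matStar A).add_mem (hA 1 0) ((matStar A).mul_mem_right _ _ (hA 1 1))
      have hym : y ∈ matStar A :=
        (matStar A).sub_mem (hA 0 1) ((matStar A).mul_mem_right _ _ hxm)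
      rw [TwoSidedIdeal.span_le, Set.singleton_subset_iff]
      exact (matStar A).add_mem ((matStar A).add_mem hxm ((matStar A).mul_mem_left _ _ hdm))
        ((matStar A).mul_mem_right _ _ hym)
    · set I := TwoSidedIdeal.span {z} with hI
      have hzm : z ∈ I := TwoSidedIdeal.subset_span rfl
      have hwm : w ∈ I := by rw [hp₂]; exact I.mul_mem_right _ _ hzm
      have hym : y ∈ I := by rw [hq₂]; exact I.mul_mem_right _ _ hzm
      have hxm : x ∈ I := by rw [hp₁]; exact I.mul_mem_left _ _ hwm
      have hdm : d ∈ I := by rw [hq₁]; exact I.mul_mem_left _ _ hwm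
      have m01 : A 0 1 ∈ I := by rw [h01]; exact I.add_mem hym (I.mul_mem_right _ _ hxm)
      have m00 : A 0 0 ∈ I := by rw [h00]; exact I.sub_mem hxm (I.mul_mem_right _ _ m01)
      have m11 : A 1 1 ∈ I := by rw [hq]; exact I.mul_mem_right _ _ hdm
      have m10 : A 1 0 ∈ I := by rw [hp]; exact I.mul_mem_right _ _ hdm
      rw [matStar, TwoSidedIdeal.span_le]
      rintro _ ⟨i, j, rfl⟩
      fin_cases i <;> fin_cases j <;> assumption
end

section
/- Let R be a (not necessarily commutative) Bézout ring of stable range 1. Then for every 2×2 matrix A over R there exist elements a, b, c ∈ R such that A is equivalent to the lower-triangular matrix [[a, 0], [b, c]] and RaR = A_*. -/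
open Matrix

section StableRange

variable {R : Type*} [Ring R]

/-- Rings of stable range `1` are Dedekind finite. -/
theorem StableRangeOne.mul_eq_one_comm (hS : StableRangeOne R) {x y : R} (h : x * y = 1) :
    y * x = 1 := by
  obtain ⟨t, u, hu⟩ := hS y (1 - y * x) ⟨x, 1, by simp⟩
  have hv : x * (y + (1 - y * x) * t) = 1 := by
    have : x * (y + (1 - y * x) * t) = x * y + (x - x * y * x) * t := by noncomm_ring
    rw [this, h, one_mul, sub_self, zero_mul, add_zero]
  obtain rfl : x = u := left_inv_eq_right_inv hv hu
  have hy : y + (1 - y * x) * t = y := left_inv_eq_right_inv hu h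
  rwa [hy] at hu

/-- Stable range `1` is a left-right symmetric condition. -/
theorem StableRangeOne.exists_left (hS : StableRangeOne R) {a b x y : R}
    (h : x * a + y * b = 1) : ∃ s u, u * (a + s * b) = 1 := by
  obtain ⟨t, v, hv⟩ := hS x (y * b) ⟨a, 1, by simpa using h⟩
  have hb : y * b = 1 - x * a := eq_sub_of_add_eq' h
  rw [hb] at hv
  refine ⟨(1 - a * t) * v * y, x + t * (1 - a * x), ?_⟩
  have hw : (1 - a * t) * v * y * b = (1 - a * t) * v * (1 - x * a) := by
    rw [mul_assoc _ y b, hb]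
  have h₁ : x * (1 - a * t) * v = 1 - t * v := by
    have : x * (1 - a * t) = x + (1 - x * a) * t - t := by noncomm_ring
    rw [this, sub_mul, hv]
  have h₂ : (1 - a * x) * (1 - a * t) * v = v - a := by
    have : (1 - a * x) * (1 - a * t) = 1 - a * (x + (1 - x * a) * t) := by noncomm_ring
    rw [this, sub_mul, mul_assoc, hv, one_mul, mul_one]
  rw [hw]
  calc (x + t * (1 - a * x)) * (a + (1 - a * t) * v * (1 - x * a))
      = x * a + t * (1 - a * x) * a + (x * (1 - a * t) * v) * (1 - x * a)
        + t * ((1 - a * x) * (1 - a * t) * v) * (1 - x * a) := by noncomm_ring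
    _ = 1 := by rw [h₁, h₂]; noncomm_ring

/-- In a Bézout ring of stable range `1`, the right ideal `aR + bR` is generated by some
`a + bt`. -/
theorem IsBezoutRing.exists_right_generator (hB : IsBezoutRing R) (hS : StableRangeOne R)
    (a b : R) : ∃ t p q, a = (a + b * t) * p ∧ b = (a + b * t) * q := by
  obtain ⟨d, hd⟩ := hB.1 (Ideal.span {MulOpposite.op a, MulOpposite.op b})
    (Submodule.fg_span (Set.toFinite _))
  obtain ⟨a₀, ha⟩ := Ideal.mem_span_singleton'.1
    (hd ▸ Ideal.subset_span (Set.mem_insert _ _) : MulOpposite.op a ∈ Ideal.span {d})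
  obtain ⟨b₀, hb⟩ := Ideal.mem_span_singleton'.1
    (hd ▸ Ideal.subset_span (Set.mem_insert_of_mem _ rfl) : MulOpposite.op b ∈ Ideal.span {d})
  obtain ⟨x, y, hxy⟩ := Ideal.mem_span_pair.1 (hd ▸ Ideal.mem_span_singleton_self d)
  replace ha := congrArg MulOpposite.unop ha
  replace hb := congrArg MulOpposite.unop hb
  replace hxy := congrArg MulOpposite.unop hxy
  simp only [MulOpposite.unop_mul, MulOpposite.unop_add, MulOpposite.unop_op] at ha hb hxy
  generalize MulOpposite.unop d = d, MulOpposite.unop a₀ = a₀, MulOpposite.unop b₀ = b₀,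
    MulOpposite.unop x = x, MulOpposite.unop y = y at ha hb hxy
  obtain ⟨t, u, hu⟩ := hS a₀ (1 - a₀ * x) ⟨x, 1, by simp⟩
  have hdx : d * (1 - a₀ * x) = b * y := by
    rw [mul_sub, mul_one, ← mul_assoc, ha]
    exact sub_eq_of_eq_add' hxy.symm
  have hgen : (a + b * (y * t)) * u = d := by
    have : a + b * (y * t) = d * (a₀ + (1 - a₀ * x) * t) := by
      rw [mul_add, ha, ← mul_assoc d, hdx, mul_assoc]
    rw [this, mul_assoc, hu, mul_one]
  exact ⟨y * t, u * a₀, u * b₀, by rw [← mul_assoc, hgen, ha], by rw [← mul_assoc, hgen, hb]⟩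

/-- In a Bézout ring of stable range `1`, the left ideal `Ra + Rb` is generated by some
`a + sb`. -/
theorem IsBezoutRing.exists_left_generator (hB : IsBezoutRing R) (hS : StableRangeOne R)
    (a b : R) : ∃ s p q, a = p * (a + s * b) ∧ b = q * (a + s * b) := by
  obtain ⟨d, hd⟩ := hB.2 (Ideal.span {a, b}) (Submodule.fg_span (Set.toFinite _))
  obtain ⟨a₀, ha⟩ := Ideal.mem_span_singleton'.1
    (hd ▸ Ideal.subset_span (Set.mem_insert _ _) : a ∈ Ideal.span {d})
  obtain ⟨b₀, hb⟩ := Ideal.mem_span_singleton'.1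
    (hd ▸ Ideal.subset_span (Set.mem_insert_of_mem _ rfl) : b ∈ Ideal.span {d})
  obtain ⟨x, y, hxy⟩ := Ideal.mem_span_pair.1 (hd ▸ Ideal.mem_span_singleton_self d)
  obtain ⟨s, u, hu⟩ := hS.exists_left (a := a₀) (b := 1 - x * a₀) (x := x) (y := 1) (by simp)
  have hdx : (1 - x * a₀) * d = y * b := by
    rw [sub_mul, one_mul, mul_assoc, ha]
    exact sub_eq_of_eq_add' hxy.symm
  have hgen : u * (a + s * y * b) = d := by
    have : a + s * y * b = (a₀ + s * (1 - x * a₀)) * d := by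
      rw [add_mul, ha, mul_assoc s _ d, hdx, mul_assoc]
    rw [this, ← mul_assoc, hu, one_mul]
  exact ⟨s * y, a₀ * u, b₀ * u, by rw [mul_assoc, hgen, ha], by rw [mul_assoc, hgen, hb]⟩

theorem isUnit_upperUnitriangular (s : R) : IsUnit (Matrix.of ![![1, s], ![0, 1]]) :=
  ⟨⟨Matrix.of ![![1, s], ![0, 1]], Matrix.of ![![1, -s], ![0, 1]],
    by ext i j; fin_cases i <;> fin_cases j <;> simp [Matrix.mul_apply],
    by ext i j; fin_cases i <;> fin_cases j <;> simp [Matrix.mul_apply]⟩, rfl⟩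

theorem isUnit_lowerUnitriangular (s : R) : IsUnit (Matrix.of ![![1, 0], ![s, 1]]) :=
  ⟨⟨Matrix.of ![![1, 0], ![s, 1]], Matrix.of ![![1, 0], ![-s, 1]],
    by ext i j; fin_cases i <;> fin_cases j <;> simp [Matrix.mul_apply],
    by ext i j; fin_cases i <;> fin_cases j <;> simp [Matrix.mul_apply]⟩, rfl⟩

/-- Reduction of a `2 × 2` matrix to lower triangular form by column operations. -/
theorem IsBezoutRing.exists_mul_eq_lowerTriangular (hB : IsBezoutRing R) (hS : StableRangeOne R)
    (A : Matrix (Fin 2) (Fin 2) R) : ∃ (Q : Matrix (Fin 2) (Fin 2) R) (a b c p : R),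
      IsUnit Q ∧ A * Q = Matrix.of ![![a, 0], ![b, c]] ∧ A 0 0 = a * p := by
  obtain ⟨t, p, q, hp, hq⟩ := hB.exists_right_generator hS (A 0 0) (A 0 1)
  refine ⟨Matrix.of ![![1, 0], ![t, 1]] * Matrix.of ![![1, -q], ![0, 1]],
    A 0 0 + A 0 1 * t, A 1 0 + A 1 1 * t, A 1 1 - (A 1 0 + A 1 1 * t) * q, p,
    (isUnit_lowerUnitriangular t).mul (isUnit_upperUnitriangular (-q)), ?_, hp⟩
  rw [← Matrix.mul_assoc]
  ext i j
  fin_cases i <;> fin_cases j <;> simp [Matrix.mul_apply, Fin.sum_univ_two]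
  · rw [← hq, neg_add_cancel]
  · abel

theorem apply_mem_matStar {m n : ℕ} (A : Matrix (Fin m) (Fin n) R) (i : Fin m) (j : Fin n) :
    A i j ∈ matStar A :=
  TwoSidedIdeal.subset_span ⟨i, j, rfl⟩

theorem matStar_le_iff {m n : ℕ} {A : Matrix (Fin m) (Fin n) R} {I : TwoSidedIdeal R} :
    matStar A ≤ I ↔ ∀ i j, A i j ∈ I := by
  rw [matStar, TwoSidedIdeal.span_le]
  exact ⟨fun h i j => h ⟨i, j, rfl⟩, by rintro h _ ⟨i, j, rfl⟩; exact h i j⟩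

theorem matStar_mul_le_left {l m n : ℕ} (A : Matrix (Fin l) (Fin m) R)
    (B : Matrix (Fin m) (Fin n) R) : matStar (A * B) ≤ matStar A :=
  matStar_le_iff.2 fun i _ => Matrix.mul_apply (M := A) (N := B) ▸ sum_mem fun k _ =>
    TwoSidedIdeal.mul_mem_right _ _ _ (apply_mem_matStar A i k)

theorem matStar_mul_le_right {l m n : ℕ} (A : Matrix (Fin l) (Fin m) R)
    (B : Matrix (Fin m) (Fin n) R) : matStar (A * B) ≤ matStar B :=
  matStar_le_iff.2 fun _ j => Matrix.mul_apply (M := A) (N := B) ▸ sum_mem fun k _ =>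
    TwoSidedIdeal.mul_mem_left _ _ _ (apply_mem_matStar B k j)

end StableRange

/-- Over a Bézout ring of stable range 1, every `2 × 2` matrix `A` is
equivalent to the lower-triangular matrix `[[a, 0], [b, c]]` with `RaR = A_*`. -/
theorem stmt1 {R : Type*} [Ring R] [Nontrivial R]
    (hB : IsBezoutRing R) (hS : StableRangeOne R)
    (A : Matrix (Fin 2) (Fin 2) R) :
    ∃ a b c : R,
      MatEquiv A (Matrix.of ![![a, 0], ![b, c]]) ∧
      TwoSidedIdeal.span {a} = matStar A := by
  obtain ⟨Q, a, b, c, -, hQ, hT, -⟩ := hB.exists_mul_eq_lowerTriangular hS A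
  obtain ⟨t, -, q, -, hq⟩ : ∃ t p q, b = (b + c * t) * p ∧ c = (b + c * t) * q :=
    hB.exists_right_generator hS b c
  obtain ⟨s, p₁, p₂, hp₁, hp₂⟩ := hB.exists_left_generator hS a (b + c * t)
  set P : Matrix (Fin 2) (Fin 2) R := Matrix.of ![![1, s], ![0, 1]] with hP
  set L : Matrix (Fin 2) (Fin 2) R := Matrix.of ![![1, 0], ![t, 1]] with hL
  have hPu : IsUnit P := isUnit_upperUnitriangular s
  have hLu : IsUnit L := isUnit_lowerUnitriangular t
  obtain ⟨Q', a', b', c', r, hQ', hT', hr⟩ :=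
    hB.exists_mul_eq_lowerTriangular hS (P * (A * Q) * L)
  have hr' : a + s * (b + c * t) = a' * r := by
    rw [← hr, hT]
    simp [hP, hL, Matrix.mul_apply, Fin.sum_univ_two, mul_add, add_assoc, mul_assoc]
  refine ⟨a', b', c', ?_, le_antisymm ?_ ?_⟩
  · rw [← hT']
    obtain ⟨Q, rfl⟩ := hQ
    obtain ⟨Q', rfl⟩ := hQ'
    obtain ⟨U, hU⟩ := hPu
    obtain ⟨V, hV⟩ := hLu
    rw [← hU, ← hV]
    refine ⟨↑U⁻¹, ↑(Q * V * Q')⁻¹, U⁻¹.isUnit, (Q * V * Q')⁻¹.isUnit, ?_⟩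
    simp [mul_assoc]
  · rw [TwoSidedIdeal.span_le, Set.singleton_subset_iff]
    have ha' : a' = (P * (A * Q) * L * Q') 0 0 := by simp [hT']
    have hle : matStar (P * (A * Q) * L * Q') ≤ matStar A :=
      (matStar_mul_le_left _ _).trans <| (matStar_mul_le_left _ _).trans <|
        (matStar_mul_le_right _ _).trans (matStar_mul_le_left _ _)
    exact hle (ha' ▸ apply_mem_matStar _ 0 0)
  · have hA : matStar A ≤ matStar (A * Q) := by
      obtain ⟨Q, rfl⟩ := hQ
      simpa [Matrix.mul_assoc] using matStar_mul_le_left (A * Q.val) Q⁻¹.val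
    refine hA.trans (hT ▸ matStar_le_iff.2 ?_)
    set I := TwoSidedIdeal.span {a'}
    have hg : a + s * (b + c * t) ∈ I :=
      hr' ▸ I.mul_mem_right _ _ (TwoSidedIdeal.subset_span rfl)
    have haI : a ∈ I := hp₁ ▸ I.mul_mem_left _ _ hg
    have hbI : b + c * t ∈ I := hp₂ ▸ I.mul_mem_left _ _ hg
    have hcI : c ∈ I := hq ▸ I.mul_mem_right _ _ hbI
    have hbI' : b ∈ I := by
      simpa using I.sub_mem hbI (I.mul_mem_right _ t hcI)
    intro i j
    fin_cases i <;> fin_cases j <;> simp [haI, hbI', hcI, I.zero_mem]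
end

section
/- Let R be an elementary divisor ring with the DK-property. Then for every matrix A over R there exists a matrix C = diag(ε₁, …, ε_k, 0, …, 0) such that A is equivalent to C, the elements ε₁, …, ε_{k−1} are duo elements, and Rε_{i+1}R ⊆ Rε_i ∩ ε_iR for all i = 1, …, k−1. -/
open Matrix

/-- A matrix is equivalent to its product with invertible matrices on both sides. -/
theorem matEquiv_mul_mul {R : Type*} [Ring R] {m n : ℕ} (A : Matrix (Fin m) (Fin n) R)
    {P : Matrix (Fin m) (Fin m) R} {Q : Matrix (Fin n) (Fin n) R}
    (hP : IsUnit P) (hQ : IsUnit Q) : MatEquiv A (P * A * Q) := by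
  obtain ⟨u, rfl⟩ := hP
  obtain ⟨v, rfl⟩ := hQ
  refine ⟨(u⁻¹).val, (v⁻¹).val, u⁻¹.isUnit, v⁻¹.isUnit, ?_⟩
  calc A = (1 : Matrix (Fin m) (Fin m) R) * A * (1 : Matrix (Fin n) (Fin n) R) := by rw [Matrix.one_mul, Matrix.mul_one]
    _ = ((u⁻¹).val * u.val) * A * (v.val * (v⁻¹).val) := by rw [u.inv_mul, v.mul_inv]
    _ = (u⁻¹).val * (u.val * A * v.val) * (v⁻¹).val := by simp only [Matrix.mul_assoc]

/-- Over a ring with the DK-property, if `RbR ⊆ aR` for a nonzero `b`, then `a` is duo. -/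
theorem DKProp.isDuoElem_of_span_subset {R : Type*} [Ring R] (h : DKProp R) {a b : R}
    (hb : b ≠ 0) (hab : ∀ x ∈ TwoSidedIdeal.span {b}, ∃ r, x = a * r) : IsDuoElem a := by
  obtain ⟨c, hc, hduo⟩ := h.1 b
  have hc0 : c ≠ 0 := by
    rintro rfl
    obtain ⟨r, hr⟩ := (hc b).1 (TwoSidedIdeal.subset_span rfl)
    exact hb (by rw [hr, zero_mul])
  obtain ⟨r, hr⟩ := hab c ((hc c).2 ⟨1, (mul_one c).symm⟩)
  exact h.2 c a ⟨hc0, hduo⟩ ⟨1, r, by rw [one_mul, hr]⟩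

/-- Over a ring with the DK-property, every diagonal entry of a total-divisor diagonal matrix
with a nonzero successor is duo. -/
theorem IsTotalDivisorDiag.isDuoElem {R : Type*} [Ring R] {m n : ℕ}
    {D : Matrix (Fin m) (Fin n) R} (hD : IsTotalDivisorDiag D) (h : DKProp R)
    (i : Fin m) (j : Fin n) (i' : Fin m) (j' : Fin n) (hij : (i : ℕ) = j)
    (hij' : (i' : ℕ) = j') (hi : (i' : ℕ) = i + 1) (hne : D i' j' ≠ 0) : IsDuoElem (D i j) :=
  h.isDuoElem_of_span_subset hne fun x hx => (hD.2 i j i' j' hij hij' hi x hx).1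

/-- In an elementary divisor ring with the DK-property, every matrix is
equivalent to a matrix `diag(ε₁, …, ε_k, 0, …, 0)` with `ε₁, …, ε_{k-1}` duo and
`R ε_{i+1} R ⊆ R ε_i ∩ ε_i R`. -/
theorem stmt2 {R : Type*} [Ring R] [Nontrivial R]
    (hED : IsEDRing R) (hDK : DKProp R) :
    ∀ (m n : ℕ) (A : Matrix (Fin m) (Fin n) R),
      ∃ C : Matrix (Fin m) (Fin n) R, MatEquiv A C ∧ IsEDKDiag C := by
  intro m n A
  obtain ⟨P, Q, hP, hQ, hD⟩ := hED m n A
  exact ⟨P * A * Q, matEquiv_mul_mul A hP hQ, hD, hD.isDuoElem hDK⟩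
end

section
/- Let R be a principal ideal domain (a domain in which every right ideal and every left ideal is principal). Then R is an elementary divisor ring with the DK-property if and only if R has the EDK-property. -/
open Matrix

/-- Over a Noetherian module, a submodule stable under a surjective endomorphism is also
stable under taking preimages. -/
lemma Submodule.comap_le_of_surjective_endomorphism {R M : Type*} [Ring R] [AddCommGroup M]
    [Module R M] [IsNoetherian R M] {N : Submodule R M} {g : M →ₗ[R] M}
    (hg : Function.Surjective g) (hN : N ≤ N.comap g) : N.comap g ≤ N := by
  intro v hv
  have hsurj : Function.Surjective (N.mapQ N g hN) := by
    intro q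
    obtain ⟨x, rfl⟩ := N.mkQ_surjective q
    obtain ⟨w, rfl⟩ := hg x
    exact ⟨N.mkQ w, rfl⟩
  have hinj := IsNoetherian.injective_of_surjective_endomorphism _ hsurj
  rw [← Submodule.Quotient.mk_eq_zero]
  apply hinj
  rw [map_zero, Submodule.mapQ_apply, Submodule.Quotient.mk_eq_zero]
  exact hv

section

variable {R : Type*} [Ring R] [IsDomain R]

/-- If a two-sided ideal of a domain is principal on both sides, then its left and right
generators can be chosen to coincide. -/
lemma TwoSidedIdeal.exists_common_generator {I : TwoSidedIdeal R} {b c : R}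
    (hb : ∀ x, x ∈ I ↔ ∃ r, x = b * r) (hc : ∀ x, x ∈ I ↔ ∃ s, x = s * c) :
    ∀ x, x ∈ I ↔ ∃ s, x = s * b := by
  have hbI : b ∈ I := (hb b).2 ⟨1, (mul_one b).symm⟩
  have hcI : c ∈ I := (hc c).2 ⟨1, (one_mul c).symm⟩
  intro x
  refine ⟨fun hx => ?_, fun ⟨s, hs⟩ => hs ▸ I.mul_mem_left s b hbI⟩
  obtain ⟨u, hu⟩ := (hc b).1 hbI
  obtain ⟨v, hv⟩ := (hb c).1 hcI
  obtain ⟨w, hw⟩ := (hc _).1 (I.mul_mem_right c v hcI)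
  obtain ⟨k, rfl⟩ := (hc x).1 hx
  rcases eq_or_ne c 0 with h0 | h0
  · exact ⟨0, by simp [h0]⟩
  have huw : u * w = 1 := by
    apply mul_right_cancel₀ h0
    rw [mul_assoc, ← hw, ← mul_assoc, ← hu, ← hv, one_mul]
  have hwu : w * u = 1 := mul_eq_one_symm huw
  refine ⟨k * w, ?_⟩
  rw [hu, mul_assoc, ← mul_assoc w, hwu, one_mul]

/-- Dubrovin's property holds in every principal ideal domain. -/
lemma dProp_of_principal (hr : ∀ I : Ideal Rᵐᵒᵖ, ∃ d, I = Ideal.span {d})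
    (hl : ∀ I : Ideal R, ∃ d, I = Ideal.span {d}) : DProp R := by
  intro a
  obtain ⟨c, hc⟩ := hl (TwoSidedIdeal.asIdeal (TwoSidedIdeal.span {a}))
  obtain ⟨b, hb⟩ := hr (TwoSidedIdeal.asIdealOpposite (TwoSidedIdeal.span {a}))
  have hb' : ∀ x, x ∈ TwoSidedIdeal.span {a} ↔ ∃ r, x = b.unop * r := by
    intro x
    have h := TwoSidedIdeal.mem_asIdealOpposite (I := TwoSidedIdeal.span {a})
      (x := MulOpposite.op x)
    rw [hb, Ideal.mem_span_singleton'] at h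
    rw [← MulOpposite.unop_op x, ← h]
    constructor
    · rintro ⟨r, hr⟩
      exact ⟨r.unop, by rw [← hr, MulOpposite.unop_mul]⟩
    · rintro ⟨r, hr⟩
      exact ⟨MulOpposite.op r, MulOpposite.unop_injective (by simpa using hr.symm)⟩
  have hc' : ∀ x, x ∈ TwoSidedIdeal.span {a} ↔ ∃ s, x = s * c := by
    intro x
    rw [← TwoSidedIdeal.mem_asIdeal, hc, Ideal.mem_span_singleton']
    simp only [eq_comm]
  exact ⟨b.unop, hb', fun x =>
    (hb' x).symm.trans (TwoSidedIdeal.exists_common_generator hb' hc' x)⟩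

/-- A left factor of a duo element is also a right factor. -/
lemma IsDuoElem.exists_eq_mul_left {a x y : R} (ha : IsDuoElem a) (hxy : a = x * y) :
    ∃ y', a = y' * x := by
  obtain ⟨y', hy'⟩ := (ha.2 (a * y)).1 ⟨y, rfl⟩
  have hy : y ≠ 0 := by
    rintro rfl
    exact ha.1 (by simpa using hxy)
  refine ⟨y', ?_⟩
  apply mul_right_cancel₀ hy
  rw [mul_assoc, ← hxy, hy']

/-- A generator of the same left ideal as a duo element is duo. -/
lemma IsDuoElem.unit_mul {e s u : R} (he : IsDuoElem e) (hu : u * s = 1) :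
    IsDuoElem (s * e) := by
  have hsu : s * u = 1 := mul_eq_one_symm hu
  refine ⟨mul_ne_zero (left_ne_zero_of_mul_eq_one hsu) he.1, fun x => ⟨?_, ?_⟩⟩
  · rintro ⟨r, rfl⟩
    obtain ⟨k, hk⟩ := (he.2 (e * r)).1 ⟨r, rfl⟩
    exact ⟨s * k * u, by rw [mul_assoc s, hk, mul_assoc (s * k), ← mul_assoc u, hu, one_mul,
      mul_assoc]⟩
  · rintro ⟨k, rfl⟩
    obtain ⟨r, hr⟩ := (he.2 (u * (k * s) * e)).2 ⟨_, rfl⟩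
    exact ⟨r, by rw [mul_assoc s, ← hr, ← mul_assoc, ← mul_assoc, ← mul_assoc, hsu, one_mul,
      mul_assoc]⟩

/-- A right factor of a duo element is duo over a Noetherian domain with the EDK-property. -/
lemma EDKProp.isDuoElem_of_eq_mul [IsNoetherianRing R] (h : EDKProp R) {a y z : R}
    (ha : IsDuoElem a) (hyz : a = y * z) : IsDuoElem z := by
  set A : Matrix (Fin 2) (Fin 2) R := Matrix.diagonal ![z, a] with hA
  obtain ⟨P, Q, hP, hQ, ⟨hdiag, hdvd⟩, hduo⟩ := h 2 2 A
  set D := P * A * Q with hD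
  have hD01 : D 0 1 = 0 := hdiag 0 1 (by decide)
  have hD10 : D 1 0 = 0 := hdiag 1 0 (by decide)
  obtain ⟨Pi, hPPi, hPiP⟩ := isUnit_iff_exists.1 hP
  obtain ⟨Qi, hQQi, hQiQ⟩ := isUnit_iff_exists.1 hQ
  have hPiD : Pi * D = A * Q := by
    rw [hD, ← Matrix.mul_assoc, ← Matrix.mul_assoc, hPiP, Matrix.one_mul]
  have hAeq : A = Pi * D * Qi := by
    rw [hPiD, Matrix.mul_assoc, hQQi, Matrix.mul_one]
  obtain ⟨t, ht⟩ : ∃ t, a = t * D 1 1 := by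
    obtain ⟨m, hm⟩ := (ha.2 (a * Qi 1 0)).1 ⟨_, rfl⟩
    obtain ⟨n, hn⟩ := (ha.2 (a * Qi 1 1)).1 ⟨_, rfl⟩
    have hv : ![m * y, n] ᵥ* A = ![0, a] ᵥ* Qi := by
      ext i
      fin_cases i
      · simp [hA, Matrix.vecMul, dotProduct, Fin.sum_univ_two, hm, mul_assoc, ← hyz]
      · simp [hA, Matrix.vecMul, dotProduct, Fin.sum_univ_two, hn]
    have hw : (![m * y, n] ᵥ* Pi) ᵥ* D = ![0, a] := by
      rw [Matrix.vecMul_vecMul, hPiD, ← Matrix.vecMul_vecMul, hv, Matrix.vecMul_vecMul, hQiQ,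
        Matrix.vecMul_one]
    refine ⟨(![m * y, n] ᵥ* Pi) 1, ?_⟩
    have := congrFun hw 1
    rw [Matrix.vecMul, dotProduct, Fin.sum_univ_two, hD01, mul_zero, zero_add] at this
    exact this.symm
  have hD11 : D 1 1 ≠ 0 := fun h0 => ha.1 (by rw [ht, h0, mul_zero])
  have he : IsDuoElem (D 0 0) := hduo 0 0 1 1 rfl rfl rfl hD11
  obtain ⟨s, hs⟩ : ∃ s, z = s * D 0 0 := by
    obtain ⟨k, hk⟩ := (hdvd 0 0 1 1 rfl rfl rfl _ (TwoSidedIdeal.subset_span rfl)).2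
    obtain ⟨q₀, hq₀⟩ := (he.2 (D 0 0 * Qi 0 0)).1 ⟨_, rfl⟩
    obtain ⟨q₁, hq₁⟩ := (he.2 (D 0 0 * Qi 1 0)).1 ⟨_, rfl⟩
    refine ⟨Pi 0 0 * q₀ + Pi 0 1 * k * q₁, ?_⟩
    have h00 := congrFun (congrFun hAeq 0) 0
    simp only [hA, Matrix.mul_apply, Fin.sum_univ_two, hD01, hD10, mul_zero, add_zero, zero_add,
      Matrix.diagonal_apply_eq, Matrix.cons_val_zero] at h00
    rw [h00, hk, add_mul, mul_assoc, hq₀, mul_assoc (Pi 0 1), mul_assoc k, hq₁]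
    simp only [mul_assoc]
  set T : Matrix (Fin 2) (Fin 2) R := Matrix.diagonal ![s, t] with hT
  have hTD : A = T * D := by
    ext i j
    fin_cases i <;> fin_cases j <;> simp [hA, hT, Matrix.diagonal_mul, hD01, hD10, ← hs, ← ht]
  have hDQi : D * Qi = P * T * D := by
    rw [Matrix.mul_assoc P, ← hTD, hD, Matrix.mul_assoc (P * A), hQQi, Matrix.mul_one]
  have hle := Submodule.comap_le_of_surjective_endomorphism
    (N := LinearMap.range (Matrix.vecMulLinear D)) (g := Matrix.vecMulLinear Qi)
    (fun v => ⟨v ᵥ* Q, by simp [Matrix.vecMul_vecMul, hQQi]⟩)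
    (by
      rintro _ ⟨w, rfl⟩
      exact ⟨w ᵥ* (P * T), by simp [Matrix.vecMul_vecMul, hDQi]⟩)
  obtain ⟨w, hw⟩ := hle (x := ![1, 0] ᵥ* (D * Q))
    ⟨![1, 0], by simp [Matrix.vecMul_vecMul, Matrix.mul_assoc, hQQi]⟩
  have hw' : (w ᵥ* P) ᵥ* T ᵥ* D = ![1, 0] ᵥ* D := by
    have := congrArg (· ᵥ* Qi) hw
    simpa [Matrix.vecMul_vecMul, Matrix.mul_assoc, hQQi, hDQi] using this
  rw [hs]
  refine he.unit_mul (u := (w ᵥ* P) 0) ?_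
  apply mul_right_cancel₀ he.1
  have h0 := congrFun hw' 0
  rw [hT, Matrix.vecMul, dotProduct, Fin.sum_univ_two, hD10, Matrix.vecMul_diagonal] at h0
  simpa [Matrix.vecMul, dotProduct, Fin.sum_univ_two, hD10] using h0

end

/-- A principal ideal domain is an elementary divisor ring with the
DK-property iff it has the EDK-property. -/
theorem stmt3 {R : Type*} [Ring R] [IsDomain R]
    (hPIDright : ∀ I : Ideal Rᵐᵒᵖ, ∃ d, I = Ideal.span {d})
    (hPIDleft : ∀ I : Ideal R, ∃ d, I = Ideal.span {d}) :
    (IsEDRing R ∧ DKProp R) ↔ EDKProp R := by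
  constructor
  · rintro ⟨hED, hD, hK⟩ m n A
    obtain ⟨P, Q, hP, hQ, hdiag⟩ := hED m n A
    refine ⟨P, Q, hP, hQ, hdiag, fun i j i' j' hij hij' hsucc hne => ?_⟩
    obtain ⟨b, hb, hduo⟩ := hD ((P * A * Q) i' j')
    have hb0 : b ≠ 0 := by
      rintro rfl
      obtain ⟨r, hr⟩ := (hb _).1 (TwoSidedIdeal.subset_span rfl)
      exact hne (by rw [hr, zero_mul])
    obtain ⟨r, hr⟩ := (hdiag.2 i j i' j' hij hij' hsucc b ((hb b).2 ⟨1, by simp⟩)).1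
    exact hK b _ ⟨hb0, hduo⟩ ⟨1, r, by rw [one_mul, hr]⟩
  · intro h
    refine ⟨fun m n A => ?_, dProp_of_principal hPIDright hPIDleft, ?_⟩
    · obtain ⟨P, Q, hP, hQ, hD⟩ := h m n A
      exact ⟨P, Q, hP, hQ, hD.1⟩
    · rintro a z ha ⟨u, v, huv⟩
      have : IsNoetherianRing R := by
        refine isNoetherianRing_iff_ideal_fg R |>.2 fun I => ?_
        obtain ⟨d, rfl⟩ := hPIDleft I
        exact ⟨{d}, by simp⟩
      obtain ⟨w, hw⟩ := ha.exists_eq_mul_left huv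
      exact h.isDuoElem_of_eq_mul ha (hw.trans (mul_assoc w u z).symm)
end

section
/- A Hermite ring R has the EDK-property if and only if every 2×2 matrix A over R is equivalent to a diagonal matrix diag(ε, a) with a ∈ R such that either RaR ⊆ εR = Rε or ε = 0. -/
open Matrix

section Operations

variable {R : Type*} [Ring R] {ι κ : Type*}

/-- Left multiplication of rows `i` and `k` of `A` by the `2 × 2` matrix `P`. -/
def rowOp [DecidableEq ι] (P : Matrix (Fin 2) (Fin 2) R) (i k : ι) (A : Matrix ι κ R) : Matrix ι κ R :=
  fun r c =>
    if r = i then P 0 0 * A i c + P 0 1 * A k c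
    else if r = k then P 1 0 * A i c + P 1 1 * A k c
    else A r c

/-- Right multiplication of columns `j` and `l` of `A` by the `2 × 2` matrix `Q`. -/
def colOp [DecidableEq κ] (Q : Matrix (Fin 2) (Fin 2) R) (j l : κ) (A : Matrix ι κ R) : Matrix ι κ R :=
  fun r c =>
    if c = j then A r j * Q 0 0 + A r l * Q 1 0
    else if c = l then A r j * Q 0 1 + A r l * Q 1 1
    else A r c

lemma rowOp_rowOp [DecidableEq ι] (P P' : Matrix (Fin 2) (Fin 2) R) {i k : ι} (h : i ≠ k)
    (A : Matrix ι κ R) :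
    rowOp P i k (rowOp P' i k A) = rowOp (P * P') i k A := by
  funext r c
  simp only [rowOp, Matrix.mul_apply, Fin.sum_univ_two, h.symm, if_true, if_false]
  split_ifs <;> noncomm_ring

lemma colOp_colOp [DecidableEq κ] (Q Q' : Matrix (Fin 2) (Fin 2) R) {j l : κ} (h : j ≠ l)
    (A : Matrix ι κ R) :
    colOp Q' j l (colOp Q j l A) = colOp (Q * Q') j l A := by
  funext r c
  simp only [colOp, Matrix.mul_apply, Fin.sum_univ_two, h.symm, if_true, if_false]
  split_ifs <;> noncomm_ring

lemma rowOp_one [DecidableEq ι] {i k : ι} (A : Matrix ι κ R) : rowOp 1 i k A = A := by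
  funext r c
  simp only [rowOp]
  split_ifs with h h' <;> simp [*]

lemma colOp_one [DecidableEq κ] {j l : κ} (A : Matrix ι κ R) : colOp 1 j l A = A := by
  funext r c
  simp only [colOp]
  split_ifs with h h' <;> simp [*]

lemma rowOp_eq_mul [DecidableEq ι] [Fintype ι] (P : Matrix (Fin 2) (Fin 2) R) (i k : ι)
    (A : Matrix ι κ R) :
    rowOp P i k A = rowOp P i k (1 : Matrix ι ι R) * A := by
  funext r c
  simp only [rowOp, Matrix.mul_apply]
  split_ifs <;>
    simp [add_mul, Finset.sum_add_distrib, Matrix.one_apply]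

lemma colOp_eq_mul [DecidableEq κ] [Fintype κ] (Q : Matrix (Fin 2) (Fin 2) R) (j l : κ)
    (A : Matrix ι κ R) :
    colOp Q j l A = A * colOp Q j l (1 : Matrix κ κ R) := by
  funext r c
  simp only [colOp, Matrix.mul_apply]
  split_ifs <;>
    simp [mul_add, Finset.sum_add_distrib, Matrix.one_apply]

lemma isUnit_rowOp_one [DecidableEq ι] [Fintype ι] {P : Matrix (Fin 2) (Fin 2) R} (hP : IsUnit P) {i k : ι}
    (h : i ≠ k) : IsUnit (rowOp P i k (1 : Matrix ι ι R)) := by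
  obtain ⟨u, rfl⟩ := hP
  refine ⟨⟨rowOp (↑u : Matrix (Fin 2) (Fin 2) R) i k 1,
    rowOp (↑u⁻¹ : Matrix (Fin 2) (Fin 2) R) i k 1, ?_, ?_⟩, rfl⟩ <;>
    rw [← rowOp_eq_mul, rowOp_rowOp _ _ h] <;> simp [rowOp_one]

lemma isUnit_colOp_one [DecidableEq κ] [Fintype κ] {Q : Matrix (Fin 2) (Fin 2) R} (hQ : IsUnit Q) {j l : κ}
    (h : j ≠ l) : IsUnit (colOp Q j l (1 : Matrix κ κ R)) := by
  obtain ⟨u, rfl⟩ := hQ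
  refine ⟨⟨colOp (↑u : Matrix (Fin 2) (Fin 2) R) j l 1,
    colOp (↑u⁻¹ : Matrix (Fin 2) (Fin 2) R) j l 1, ?_, ?_⟩, rfl⟩ <;>
    rw [← colOp_eq_mul, colOp_colOp _ _ h] <;> simp [colOp_one]

variable [DecidableEq ι] [DecidableEq κ]

/-- `Reach S T A B`: the matrix `B` arises from `A` by invertible operations on pairs of
rows in `S` and pairs of columns in `T`. -/
inductive Reach (S : Finset ι) (T : Finset κ) : Matrix ι κ R → Matrix ι κ R → Prop
  | refl (A : Matrix ι κ R) : Reach S T A A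
  | row {A B : Matrix ι κ R} (P : Matrix (Fin 2) (Fin 2) R) (i k : ι) :
      Reach S T A B → IsUnit P → i ∈ S → k ∈ S → i ≠ k → Reach S T A (rowOp P i k B)
  | col {A B : Matrix ι κ R} (Q : Matrix (Fin 2) (Fin 2) R) (j l : κ) :
      Reach S T A B → IsUnit Q → j ∈ T → l ∈ T → j ≠ l → Reach S T A (colOp Q j l B)

namespace Reach

variable {S S' : Finset ι} {T T' : Finset κ} {A B C : Matrix ι κ R}

lemma trans (h : Reach S T A B) (h' : Reach S T B C) : Reach S T A C := by
  induction h' with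
  | refl => exact h
  | row P i k _ hP hi hk hik ih => exact ih.row P i k hP hi hk hik
  | col Q j l _ hQ hj hl hjl ih => exact ih.col Q j l hQ hj hl hjl

lemma mono (hS : S ⊆ S') (hT : T ⊆ T') (h : Reach S T A B) : Reach S' T' A B := by
  induction h with
  | refl => exact .refl _
  | row P i k _ hP hi hk hik ih => exact ih.row P i k hP (hS hi) (hS hk) hik
  | col Q j l _ hQ hj hl hjl ih => exact ih.col Q j l hQ (hT hj) (hT hl) hjl

lemma exists_mul_mul_eq [Fintype ι] [Fintype κ] (h : Reach S T A B) :
    ∃ (P : Matrix ι ι R) (Q : Matrix κ κ R), IsUnit P ∧ IsUnit Q ∧ P * A * Q = B := by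
  induction h with
  | refl => exact ⟨1, 1, isUnit_one, isUnit_one, by simp⟩
  | row P i k _ hP hi hk hik ih =>
    obtain ⟨U, V, hU, hV, rfl⟩ := ih
    exact ⟨rowOp P i k 1 * U, V, (isUnit_rowOp_one hP hik).mul hU, hV, by
      rw [rowOp_eq_mul P i k (U * A * V)]; simp only [Matrix.mul_assoc]⟩
  | col Q j l _ hQ hj hl hjl ih =>
    obtain ⟨U, V, hU, hV, rfl⟩ := ih
    exact ⟨U, V * colOp Q j l 1, hU, hV.mul (isUnit_colOp_one hQ hjl), by
      rw [colOp_eq_mul Q j l (U * A * V)]; simp only [Matrix.mul_assoc]⟩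

lemma apply_eq (h : Reach S T A B) {i : ι} {j : κ} (hi : i ∉ S) (hj : j ∉ T) :
    B i j = A i j := by
  induction h with
  | refl => rfl
  | row P i' k _ hP hi' hk hik ih =>
    rw [← ih]
    simp only [rowOp]
    rw [if_neg (by rintro rfl; exact hi hi'), if_neg (by rintro rfl; exact hi hk)]
  | col Q j' l _ hQ hj' hl hjl ih =>
    rw [← ih]
    simp only [colOp]
    rw [if_neg (by rintro rfl; exact hj hj'), if_neg (by rintro rfl; exact hj hl)]

lemma mem (h : Reach S T A B) (I : TwoSidedIdeal R) (X : ι → Prop) (Y : κ → Prop)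
    (hX : ∀ i ∈ S, ∀ k ∈ S, X i → X k) (hY : ∀ j ∈ T, ∀ l ∈ T, Y j → Y l)
    (hA : ∀ i j, X i → Y j → A i j ∈ I) : ∀ i j, X i → Y j → B i j ∈ I := by
  induction h with
  | refl => exact hA
  | row P i k _ hP hi hk hik ih =>
    intro r c hr hc
    simp only [rowOp]
    split_ifs with h1 h2
    · subst h1
      exact I.add_mem (I.mul_mem_left _ _ (ih _ _ hr hc))
        (I.mul_mem_left _ _ (ih _ _ (hX _ hi _ hk hr) hc))
    · subst h2
      exact I.add_mem (I.mul_mem_left _ _ (ih _ _ (hX _ hk _ hi hr) hc))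
        (I.mul_mem_left _ _ (ih _ _ hr hc))
    · exact ih _ _ hr hc
  | col Q j l _ hQ hj hl hjl ih =>
    intro r c hr hc
    simp only [colOp]
    split_ifs with h1 h2
    · subst h1
      exact I.add_mem (I.mul_mem_right _ _ (ih _ _ hr hc))
        (I.mul_mem_right _ _ (ih _ _ hr (hY _ hj _ hl hc)))
    · subst h2
      exact I.add_mem (I.mul_mem_right _ _ (ih _ _ hr (hY _ hl _ hj hc)))
        (I.mul_mem_right _ _ (ih _ _ hr hc))
    · exact ih _ _ hr hc

lemma row_eq_zero (h : Reach S T A B) {i : ι} (hi : i ∉ S) (hA : ∀ j ∈ T, A i j = 0) :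
    ∀ j ∈ T, B i j = 0 := by
  intro j hj
  have := h.mem ⊥ (· = i) (· ∈ T)
    (by rintro i hi' k hk rfl; exact absurd hi' hi) (fun _ _ _ hl _ => hl)
    (by rintro _ j rfl hj; simpa [TwoSidedIdeal.mem_bot] using hA j hj) i j rfl hj
  simpa [TwoSidedIdeal.mem_bot] using this

lemma col_eq_zero (h : Reach S T A B) {j : κ} (hj : j ∉ T) (hA : ∀ i ∈ S, A i j = 0) :
    ∀ i ∈ S, B i j = 0 := by
  intro i hi
  have := h.mem ⊥ (· ∈ S) (· = j) (fun _ _ _ hl _ => hl)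
    (by rintro i hi' k hk rfl; exact absurd hi' hj)
    (by rintro i _ hi rfl; simpa [TwoSidedIdeal.mem_bot] using hA i hi) i j hi rfl
  simpa [TwoSidedIdeal.mem_bot] using this

end Reach

lemma exists_reach_row_eq_zero (hH : IsRightHermite R) (A : Matrix ι κ R) (i : ι)
    (T : Finset κ) {j₀ : κ} (hj₀ : j₀ ∈ T) :
    ∃ B, Reach ∅ T A B ∧ ∀ j ∈ T, j ≠ j₀ → B i j = 0 := by
  suffices H : ∀ U : Finset κ, U ⊆ T → ∃ B, Reach ∅ T A B ∧ ∀ j ∈ U, j ≠ j₀ → B i j = 0 from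
    H T subset_rfl
  intro U
  induction U using Finset.induction_on with
  | empty => exact fun _ => ⟨A, .refl A, by simp⟩
  | insert l U hl ih =>
    intro hU
    obtain ⟨B, hB, hz⟩ := ih fun x hx => hU (Finset.mem_insert_of_mem hx)
    by_cases hlj : l = j₀
    · refine ⟨B, hB, fun j hj hne => ?_⟩
      rcases Finset.mem_insert.1 hj with rfl | hj
      · exact absurd hlj hne
      · exact hz j hj hne
    · obtain ⟨Q, c, hQ, hQc⟩ := hH (B i j₀) (B i l)
      refine ⟨_, hB.col Q j₀ l hQ hj₀ (hU (Finset.mem_insert_self _ _)) (Ne.symm hlj), ?_⟩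
      intro j hj hne
      have h1 := congrFun (congrFun hQc 0) 1
      simp only [Matrix.mul_apply, Fin.sum_univ_two, Matrix.of_apply, Matrix.cons_val_zero,
        Matrix.cons_val_one] at h1
      simp only [colOp, if_neg hne]
      split_ifs with h2
      · exact h1
      · exact hz j ((Finset.mem_insert.1 hj).resolve_left h2) hne

lemma exists_reach_col_eq_zero (hH : IsLeftHermite R) (A : Matrix ι κ R) (j : κ)
    (S : Finset ι) {i₀ : ι} (hi₀ : i₀ ∈ S) :
    ∃ B, Reach S ∅ A B ∧ ∀ i ∈ S, i ≠ i₀ → B i j = 0 := by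
  suffices H : ∀ U : Finset ι, U ⊆ S → ∃ B, Reach S ∅ A B ∧ ∀ i ∈ U, i ≠ i₀ → B i j = 0 from
    H S subset_rfl
  intro U
  induction U using Finset.induction_on with
  | empty => exact fun _ => ⟨A, .refl A, by simp⟩
  | insert l U hl ih =>
    intro hU
    obtain ⟨B, hB, hz⟩ := ih fun x hx => hU (Finset.mem_insert_of_mem hx)
    by_cases hli : l = i₀
    · refine ⟨B, hB, fun i hi hne => ?_⟩
      rcases Finset.mem_insert.1 hi with rfl | hi
      · exact absurd hli hne
      · exact hz i hi hne
    · obtain ⟨P, d, hP, hPd⟩ := hH (B i₀ j) (B l j)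
      refine ⟨_, hB.row P i₀ l hP hi₀ (hU (Finset.mem_insert_self _ _)) (Ne.symm hli), ?_⟩
      intro i hi hne
      have h1 := congrFun (congrFun hPd 1) 0
      simp only [Matrix.mul_apply, Fin.sum_univ_two, Matrix.of_apply, Matrix.cons_val_zero,
        Matrix.cons_val_one] at h1
      simp only [rowOp, if_neg hne]
      split_ifs with h2
      · exact h1
      · exact hz i ((Finset.mem_insert.1 hi).resolve_left h2) hne

lemma isUnit_lowerShear (s : R) : IsUnit (!![1, 0; s, 1] : Matrix (Fin 2) (Fin 2) R) :=
  ⟨⟨_, !![1, 0; -s, 1], by simp [Matrix.one_fin_two], by simp [Matrix.one_fin_two]⟩, rfl⟩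

lemma isUnit_swap : IsUnit (!![0, 1; 1, 0] : Matrix (Fin 2) (Fin 2) R) :=
  ⟨⟨_, !![0, 1; 1, 0], by simp [Matrix.one_fin_two], by simp [Matrix.one_fin_two]⟩, rfl⟩

lemma exists_reach_col_eq_zero_of_left_multiple (A : Matrix ι κ R) {S : Finset ι}
    {T : Finset κ} {i₀ : ι} {j₀ : κ} (hi₀ : i₀ ∈ S) (hrow : ∀ j ∈ T, j ≠ j₀ → A i₀ j = 0)
    (hcol : ∀ i ∈ S, ∃ s, A i j₀ = s * A i₀ j₀) :
    ∃ B, Reach S ∅ A B ∧ (∀ j, B i₀ j = A i₀ j) ∧ (∀ i, ∀ j ∈ T, j ≠ j₀ → B i j = A i j) ∧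
      ∀ i ∈ S, i ≠ i₀ → B i j₀ = 0 := by
  suffices H : ∀ U : Finset ι, U ⊆ S → ∃ B, Reach S ∅ A B ∧ (∀ j, B i₀ j = A i₀ j) ∧
      (∀ i, ∀ j ∈ T, j ≠ j₀ → B i j = A i j) ∧ (∀ i, i ∉ U → B i j₀ = A i j₀) ∧
      ∀ i ∈ U, i ≠ i₀ → B i j₀ = 0 by
    obtain ⟨B, h1, h2, h3, -, h4⟩ := H S subset_rfl
    exact ⟨B, h1, h2, h3, h4⟩
  intro U
  induction U using Finset.induction_on with
  | empty => exact fun _ => ⟨A, .refl A, by simp⟩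
  | insert l U hl ih =>
    intro hU
    obtain ⟨B, hB, h0, hT, hout, hz⟩ := ih fun x hx => hU (Finset.mem_insert_of_mem hx)
    by_cases hli : l = i₀
    · refine ⟨B, hB, h0, hT, fun i hi => hout i fun h => hi (Finset.mem_insert_of_mem h),
        fun i hi hne => ?_⟩
      rcases Finset.mem_insert.1 hi with rfl | hi
      · exact absurd hli hne
      · exact hz i hi hne
    · have hlS := hU (Finset.mem_insert_self l U)
      obtain ⟨s, hs⟩ := hcol l hlS
      refine ⟨_, hB.row _ i₀ l (isUnit_lowerShear (-s)) hi₀ hlS (Ne.symm hli), ?_, ?_, ?_, ?_⟩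
      · intro j
        simp [rowOp, h0]
      · intro i j hj hne
        simp only [rowOp]
        split_ifs with h1 h2
        · subst h1; simp [h0]
        · subst h2; simp [h0, hrow j hj hne, hT _ j hj hne]
        · exact hT i j hj hne
      · intro i hi
        rw [Finset.mem_insert, not_or] at hi
        simp only [rowOp]
        split_ifs with h1
        · subst h1; simp [h0]
        · exact absurd ‹_› hi.1
        · exact hout i hi.2
      · intro i hi hne
        simp only [rowOp, if_neg hne]
        split_ifs with h2
        · subst h2; simp [h0, hout _ hl, hs]
        · exact hz i ((Finset.mem_insert.1 hi).resolve_left h2) hne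

/-- The rows in `S` and columns in `T` of `A` form a block sum of the entry `A i₀ j₀` and a
matrix over the ideal it generates; unless that matrix vanishes, the left and right ideals
generated by `A i₀ j₀` coincide. -/
structure IsSplit (S : Finset ι) (T : Finset κ) (i₀ : ι) (j₀ : κ) (A : Matrix ι κ R) : Prop where
  row : ∀ j ∈ T, j ≠ j₀ → A i₀ j = 0
  col : ∀ i ∈ S, i ≠ i₀ → A i j₀ = 0
  mem : ∀ i ∈ S, ∀ j ∈ T, A i j ∈ TwoSidedIdeal.span {A i₀ j₀}
  duo : (∀ i ∈ S, i ≠ i₀ → ∀ j ∈ T, j ≠ j₀ → A i j = 0) ∨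
    ∀ x : R, (∃ r, x = A i₀ j₀ * r) ↔ ∃ s, x = s * A i₀ j₀

lemma exists_eq_mul_of_mem_span {a : R} (ha : ∀ x : R, (∃ r, x = a * r) ↔ ∃ s, x = s * a)
    {x : R} (hx : x ∈ TwoSidedIdeal.span {a}) : ∃ r, x = a * r := by
  let I : TwoSidedIdeal R := TwoSidedIdeal.mk' {x | ∃ r, x = a * r} ⟨0, by simp⟩
    (by rintro _ _ ⟨r, rfl⟩ ⟨s, rfl⟩; exact ⟨r + s, by rw [mul_add]⟩)
    (by rintro _ ⟨r, rfl⟩; exact ⟨-r, by rw [mul_neg]⟩)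
    (by
      rintro x _ ⟨r, rfl⟩
      obtain ⟨s, hs⟩ := (ha (x * a)).2 ⟨x, rfl⟩
      exact ⟨s * r, by rw [← mul_assoc, hs, mul_assoc]⟩)
    (by rintro _ y ⟨r, rfl⟩; exact ⟨r * y, by rw [mul_assoc]⟩)
  have h : x ∈ I := TwoSidedIdeal.mem_span_iff.1 hx I (by
    rintro _ rfl
    exact (TwoSidedIdeal.mem_mk' _ _ _ _ _ _ _).2 ⟨1, by simp⟩)
  exact (TwoSidedIdeal.mem_mk' {x | ∃ r, x = a * r} _ _ _ _ _ x).1 h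

lemma eq_zero_of_mem_span_zero {x : R} (hx : x ∈ TwoSidedIdeal.span {(0 : R)}) : x = 0 := by
  obtain ⟨r, rfl⟩ := exists_eq_mul_of_mem_span (a := 0) (fun x => by simp) hx
  simp

/-- Every `2 × 2` matrix is equivalent to `diag(ε, a)` with `RaR ⊆ εR = Rε` or `ε = 0`. -/
def TwoByTwoReduction (R : Type*) [Ring R] : Prop :=
  ∀ A : Matrix (Fin 2) (Fin 2) R, ∃ ε a : R,
    MatEquiv A (Matrix.of ![![ε, 0], ![0, a]]) ∧
    (((∀ x ∈ TwoSidedIdeal.span {a}, ∃ r, x = ε * r) ∧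
        ∀ x : R, (∃ r, x = ε * r) ↔ ∃ s, x = s * ε) ∨ ε = 0)

lemma exists_reach_isSplit (hH : IsHermiteRing R) (h2 : TwoByTwoReduction R) (T : Finset κ)
    {j₀ : κ} (hj₀ : j₀ ∈ T) (S : Finset ι) :
    ∀ i₀ ∈ S, ∀ A : Matrix ι κ R, ∃ B, Reach S T A B ∧ IsSplit S T i₀ j₀ B := by
  induction S using Finset.strongInduction with
  | H S ih =>
  intro i₀ hi₀ A
  have self_mem (x : R) : x ∈ TwoSidedIdeal.span {x} := TwoSidedIdeal.subset_span rfl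
  by_cases hS : ∃ i₁ ∈ S, i₁ ≠ i₀
  swap
  · push Not at hS
    obtain ⟨B, hB, hz⟩ := exists_reach_row_eq_zero hH.1 A i₀ T hj₀
    refine ⟨B, hB.mono (by simp) subset_rfl, hz, fun i hi hne => absurd (hS i hi) hne, ?_,
      .inl fun i hi hne => absurd (hS i hi) hne⟩
    intro i hi j hj
    rw [hS i hi]
    by_cases hj' : j = j₀
    · rw [hj']; exact self_mem _
    · rw [hz j hj hj']; exact TwoSidedIdeal.zero_mem _
  by_cases hT : ∃ j₁ ∈ T, j₁ ≠ j₀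
  swap
  · push Not at hT
    obtain ⟨B, hB, hz⟩ := exists_reach_col_eq_zero hH.2 A j₀ S hi₀
    refine ⟨B, hB.mono subset_rfl (by simp), fun j hj hne => absurd (hT j hj) hne, hz, ?_,
      .inl fun i hi hne j hj hne' => absurd (hT j hj) hne'⟩
    intro i hi j hj
    rw [hT j hj]
    by_cases hi' : i = i₀
    · rw [hi']; exact self_mem _
    · rw [hz i hi hi']; exact TwoSidedIdeal.zero_mem _
  obtain ⟨i₁, hi₁, hi₁₀⟩ := hS
  obtain ⟨j₁, hj₁, hj₁₀⟩ := hT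
  have hi₁' : i₁ ∈ S.erase i₀ := Finset.mem_erase.2 ⟨hi₁₀, hi₁⟩
  have hj₁' : j₁ ∈ T.erase j₀ := Finset.mem_erase.2 ⟨hj₁₀, hj₁⟩
  obtain ⟨B, hAB, hB⟩ := ih _ (Finset.erase_ssubset hi₀) i₁ hi₁' A
  obtain ⟨C, hBC, hC⟩ := exists_reach_row_eq_zero hH.1 B i₀ (T.erase j₀) hj₁'
  have hcol (i : ι) : C i j₀ = B i j₀ := hBC.apply_eq (by simp) (by simp)
  have hC₁ : ∀ j ∈ T, j ≠ j₀ → C i₁ j = 0 := fun j hj hne =>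
    hBC.row_eq_zero (by simp)
      (fun j hj => hB.row j (Finset.mem_of_mem_erase hj) (Finset.ne_of_mem_erase hj)) j
      (Finset.mem_erase.2 ⟨hne, hj⟩)
  have hCmem : ∀ i j, (i ∈ S.erase i₀) → j ∈ T → C i j ∈ TwoSidedIdeal.span {C i₁ j₀} := by
    rw [hcol i₁]
    exact hBC.mem _ _ _ (by simp) (fun _ _ _ hl _ => Finset.mem_of_mem_erase hl)
      fun i j hi hj => hB.mem i hi j hj
  have hAC : Reach S T A C :=
    (hAB.mono (Finset.erase_subset _ _) subset_rfl).trans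
      (hBC.mono (by simp) (Finset.erase_subset _ _))
  obtain ⟨ε, b, ⟨P, Q, ⟨P, rfl⟩, ⟨Q, rfl⟩, hM⟩, hε⟩ :=
    h2 !![C i₀ j₀, C i₀ j₁; C i₁ j₀, C i₁ j₁]
  have hM' : (↑P⁻¹ : Matrix (Fin 2) (Fin 2) R) * !![C i₀ j₀, C i₀ j₁; C i₁ j₀, C i₁ j₁] *
      (↑Q⁻¹ : Matrix (Fin 2) (Fin 2) R) = Matrix.of ![![ε, 0], ![0, b]] := by
    rw [hM]
    simp [← mul_assoc]
  obtain ⟨D, hD⟩ : ∃ D, D = colOp (↑Q⁻¹ : Matrix (Fin 2) (Fin 2) R) j₀ j₁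
      (rowOp (↑P⁻¹ : Matrix (Fin 2) (Fin 2) R) i₀ i₁ C) := ⟨_, rfl⟩
  have hAD : Reach S T A D := by
    rw [hD]
    exact (hAC.row _ i₀ i₁ (Units.isUnit _) hi₀ hi₁ hi₁₀.symm).col _ j₀ j₁ (Units.isUnit _)
      hj₀ hj₁ hj₁₀.symm
  have h00 : D i₀ j₀ = ε := by
    have := congrFun (congrFun hM' 0) 0
    simpa [hD, rowOp, colOp, Matrix.mul_apply, Fin.sum_univ_two] using this
  have h01 : D i₀ j₁ = 0 := by
    have := congrFun (congrFun hM' 0) 1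
    simpa [hD, rowOp, colOp, Matrix.mul_apply, Fin.sum_univ_two, hj₁₀] using this
  have h10 : D i₁ j₀ = 0 := by
    have := congrFun (congrFun hM' 1) 0
    simpa [hD, rowOp, colOp, Matrix.mul_apply, Fin.sum_univ_two, hi₁₀] using this
  have h11 : D i₁ j₁ = b := by
    have := congrFun (congrFun hM' 1) 1
    simpa [hD, rowOp, colOp, Matrix.mul_apply, Fin.sum_univ_two, hi₁₀, hj₁₀] using this
  have hrest : ∀ j ∈ T, j ≠ j₀ → j ≠ j₁ → C i₀ j = 0 ∧ C i₁ j = 0 := fun j hj h h' =>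
    ⟨hC j (Finset.mem_erase.2 ⟨h, hj⟩) h', hC₁ j hj h⟩
  have hrow₀ : ∀ j ∈ T, j ≠ j₀ → D i₀ j = 0 := by
    intro j hj hne
    by_cases hj' : j = j₁
    · rw [hj', h01]
    · simp [hD, rowOp, colOp, hne, hj', hrest j hj hne hj']
  rcases hε with ⟨hbε, hεduo⟩ | rfl
  · have hb : b ∈ TwoSidedIdeal.span {ε} := by
      obtain ⟨r, hr⟩ := hbε b (self_mem b)
      rw [hr]
      exact TwoSidedIdeal.mul_mem_right _ _ _ (self_mem ε)
    have ha : C i₁ j₀ ∈ TwoSidedIdeal.span {ε} := by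
      have := congrFun (congrFun hM 1) 0
      simp [Matrix.mul_apply, Fin.sum_univ_two] at this
      rw [this]
      exact TwoSidedIdeal.add_mem _
        (TwoSidedIdeal.mul_mem_right _ _ _ (TwoSidedIdeal.mul_mem_left _ _ _ (self_mem ε)))
        (TwoSidedIdeal.mul_mem_right _ _ _ (TwoSidedIdeal.mul_mem_left _ _ _ hb))
    have hle : TwoSidedIdeal.span {C i₁ j₀} ≤ TwoSidedIdeal.span {ε} := by
      rw [TwoSidedIdeal.span_le]
      rintro _ rfl
      exact ha
    have hDmem : ∀ i ∈ S, ∀ j ∈ T, D i j ∈ TwoSidedIdeal.span {ε} := by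
      intro i hi j hj
      by_cases hi0 : i = i₀
      · subst hi0
        by_cases hj0 : j = j₀
        · rw [hj0, h00]; exact self_mem ε
        · rw [hrow₀ j hj hj0]; exact TwoSidedIdeal.zero_mem _
      by_cases hi1 : i = i₁
      · subst hi1
        by_cases hj0 : j = j₀
        · rw [hj0, h10]; exact TwoSidedIdeal.zero_mem _
        by_cases hj1 : j = j₁
        · rw [hj1, h11]; exact hb
        · simp [hD, rowOp, colOp, hj0, hj1, hrest j hj hj0 hj1]
      have hmem (j) (hj : j ∈ T) : C i j ∈ TwoSidedIdeal.span {ε} :=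
        hle (hCmem i j (Finset.mem_erase.2 ⟨hi0, hi⟩) hj)
      simp only [hD, colOp, rowOp, if_neg hi0, if_neg hi1]
      split_ifs
      · exact TwoSidedIdeal.add_mem _ (TwoSidedIdeal.mul_mem_right _ _ _ (hmem _ hj₀))
          (TwoSidedIdeal.mul_mem_right _ _ _ (hmem _ hj₁))
      · exact TwoSidedIdeal.add_mem _ (TwoSidedIdeal.mul_mem_right _ _ _ (hmem _ hj₀))
          (TwoSidedIdeal.mul_mem_right _ _ _ (hmem _ hj₁))
      · exact hmem j hj
    obtain ⟨E, hDE, hE₀, hET, hEcol⟩ :=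
      exists_reach_col_eq_zero_of_left_multiple D hi₀ hrow₀ fun i hi => by
        rw [h00]
        exact (hεduo _).1 (exists_eq_mul_of_mem_span hεduo (hDmem i hi j₀ hj₀))
    refine ⟨E, hAD.trans (hDE.mono subset_rfl (by simp)),
      fun j hj hne => by rw [hE₀, hrow₀ j hj hne], hEcol, ?_, .inr ?_⟩
    · intro i hi j hj
      rw [hE₀, h00]
      exact hDE.mem _ (· ∈ S) (· ∈ T) (fun _ _ _ hk _ => hk) (by simp)
        (fun i j hi hj => hDmem i hi j hj) i j hi hj
    · rw [hE₀, h00]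
      exact hεduo
  · have hrow : ∀ j ∈ T, D i₀ j = 0 := by
      intro j hj
      by_cases hj' : j = j₀
      · rw [hj', h00]
      · exact hrow₀ j hj hj'
    obtain ⟨E, hDE, hE⟩ := ih _ (Finset.erase_ssubset hi₀) i₁ hi₁' D
    have hE₀ := hDE.row_eq_zero (by simp) hrow
    refine ⟨_, (hAD.trans (hDE.mono (Finset.erase_subset _ _) subset_rfl)).row _ i₀ i₁
      isUnit_swap hi₀ hi₁ hi₁₀.symm, ?_, ?_, ?_, ?_⟩
    · intro j hj hne
      simp [rowOp, hE.row j hj hne]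
    · intro i hi hne
      simp only [rowOp, if_neg hne]
      split_ifs with h
      · simp [hE₀ j₀ hj₀]
      · exact hE.col i (Finset.mem_erase.2 ⟨hne, hi⟩) h
    · intro i hi j hj
      by_cases h : i = i₀
      · simpa [rowOp, h] using hE.mem i₁ hi₁' j hj
      by_cases h' : i = i₁
      · simp [rowOp, h', hi₁₀, hE₀ j hj]
      · simpa [rowOp, h, h'] using hE.mem i (Finset.mem_erase.2 ⟨h, hi⟩) j hj
    · refine hE.duo.imp ?_ ?_
      · intro hz i hi hne j hj hne'
        simp only [rowOp, if_neg hne]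
        split_ifs with h
        · simp [hE₀ j hj]
        · exact hz i (Finset.mem_erase.2 ⟨hne, hi⟩) h j hj hne'
      · intro h
        simpa [rowOp] using h

end Operations

section Diagonal

variable {R : Type*} [Ring R]

lemma exists_reach_diagonal (hH : IsHermiteRing R) (h2 : TwoByTwoReduction R) {m n : ℕ}
    (d : ℕ) : ∀ k : ℕ, m ≤ k + d → ∀ A : Matrix (Fin m) (Fin n) R,
    ∃ B : Matrix (Fin m) (Fin n) R,
      Reach {i : Fin m | k ≤ (i : ℕ)} {j : Fin n | k ≤ (j : ℕ)} A B ∧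
      (∀ (i : Fin m) (j : Fin n), k ≤ (i : ℕ) → k ≤ (j : ℕ) → (i : ℕ) ≠ (j : ℕ) → B i j = 0) ∧
      ∀ (i : Fin m) (j : Fin n) (i' : Fin m) (j' : Fin n), k ≤ (i : ℕ) →
        (i : ℕ) = (j : ℕ) → (i' : ℕ) = (j' : ℕ) → (i' : ℕ) = (i : ℕ) + 1 →
        (∀ x ∈ TwoSidedIdeal.span {B i' j'}, (∃ r, x = B i j * r) ∧ ∃ s, x = s * B i j) ∧
        (B i' j' ≠ 0 → IsDuoElem (B i j)) := by
  induction d with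
  | zero =>
    intro k hk A
    refine ⟨A, .refl A, fun i => ?_, fun i => ?_⟩ <;> intros <;> exact absurd i.2 (by omega)
  | succ d ih =>
    intro k hk A
    by_cases hkm : k < m
    swap
    · refine ⟨A, .refl A, fun i => ?_, fun i => ?_⟩ <;> intros <;> exact absurd i.2 (by omega)
    by_cases hkn : k < n
    swap
    · refine ⟨A, .refl A, fun i j => ?_, fun i j => ?_⟩ <;> intros <;>
        exact absurd j.2 (by omega)
    let i₀ : Fin m := ⟨k, hkm⟩
    let j₀ : Fin n := ⟨k, hkn⟩
    obtain ⟨B, hAB, hB⟩ := exists_reach_isSplit hH h2 {j : Fin n | k ≤ (j : ℕ)}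
      (j₀ := j₀) (by simp [j₀]) {i : Fin m | k ≤ (i : ℕ)} i₀ (by simp [i₀]) A
    obtain ⟨C, hBC, hCdiag, hCdiv⟩ := ih (k + 1) (by omega) B
    have hpivot : C i₀ j₀ = B i₀ j₀ := hBC.apply_eq (by simp [i₀]) (by simp [j₀])
    have hrow : ∀ j : Fin n, k + 1 ≤ (j : ℕ) → C i₀ j = 0 := by
      intro j hj
      refine hBC.row_eq_zero (by simp [i₀]) (fun j hj => ?_) j (by simpa using hj)
      have hj : k + 1 ≤ (j : ℕ) := by simpa using hj
      refine hB.row j (by simp; omega) fun h => ?_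
      simp [h, j₀] at hj
    have hcol : ∀ i : Fin m, k + 1 ≤ (i : ℕ) → C i j₀ = 0 := by
      intro i hi
      refine hBC.col_eq_zero (by simp [j₀]) (fun i hi => ?_) i (by simpa using hi)
      have hi : k + 1 ≤ (i : ℕ) := by simpa using hi
      refine hB.col i (by simp; omega) fun h => ?_
      simp [h, i₀] at hi
    have hmem (I : TwoSidedIdeal R)
        (hI : ∀ (i : Fin m) (j : Fin n), k + 1 ≤ (i : ℕ) → k + 1 ≤ (j : ℕ) → B i j ∈ I) :
        ∀ (i : Fin m) (j : Fin n), k + 1 ≤ (i : ℕ) → k + 1 ≤ (j : ℕ) → C i j ∈ I :=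
      hBC.mem I (fun i => k + 1 ≤ (i : ℕ)) (fun j => k + 1 ≤ (j : ℕ))
        (fun _ _ _ hk _ => by simpa using hk) (fun _ _ _ hl _ => by simpa using hl) hI
    refine ⟨C, hAB.trans (hBC.mono ?_ ?_), ?_, ?_⟩
    · intro i hi
      simp at hi ⊢
      omega
    · intro i hi
      simp at hi ⊢
      omega
    · intro i j hi hj hij
      by_cases hik : (i : ℕ) = k
      · obtain rfl : i = i₀ := Fin.ext hik
        exact hrow j (by omega)
      by_cases hjk : (j : ℕ) = k
      · obtain rfl : j = j₀ := Fin.ext hjk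
        exact hcol i (by omega)
      exact hCdiag i j (by omega) (by omega) hij
    · intro i j i' j' hi hij hij' hii'
      by_cases hik : (i : ℕ) = k
      swap
      · exact hCdiv i j i' j' (by omega) hij hij' hii'
      obtain rfl : i = i₀ := Fin.ext hik
      obtain rfl : j = j₀ := Fin.ext (by omega)
      have hCmem : C i' j' ∈ TwoSidedIdeal.span {C i₀ j₀} := by
        rw [hpivot]
        exact hmem _ (fun i j hi hj => hB.mem i (by simp; omega) j (by simp; omega)) i' j'
          (by omega) (by omega)
      rcases hB.duo with hz | hduo
      · have : C i' j' ∈ (⊥ : TwoSidedIdeal R) := by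
          refine hmem _ (fun i j hi hj => ?_) i' j' (by omega) (by omega)
          rw [hz i (by simp; omega) (fun h => by simp [h, i₀] at hi) j (by simp; omega)
            (fun h => by simp [h, j₀] at hj)]
          exact TwoSidedIdeal.zero_mem _
        have h0 : C i' j' = 0 := by simpa [TwoSidedIdeal.mem_bot] using this
        refine ⟨fun x hx => ?_, fun h => absurd h0 h⟩
        rw [h0] at hx
        rw [eq_zero_of_mem_span_zero hx]
        exact ⟨⟨0, by simp⟩, 0, by simp⟩
      · rw [← hpivot] at hduo
        refine ⟨fun x hx => ?_, fun hne => ⟨fun h0 => hne ?_, hduo⟩⟩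
        · have hle : TwoSidedIdeal.span {C i' j'} ≤ TwoSidedIdeal.span {C i₀ j₀} := by
            rw [TwoSidedIdeal.span_le]
            rintro _ rfl
            exact hCmem
          have := exists_eq_mul_of_mem_span hduo (hle hx)
          exact ⟨this, (hduo x).1 this⟩
        · rw [h0] at hCmem
          exact eq_zero_of_mem_span_zero hCmem

lemma EDKProp.of_twoByTwoReduction (hH : IsHermiteRing R) (h2 : TwoByTwoReduction R) :
    EDKProp R := by
  intro m n A
  obtain ⟨B, hAB, hdiag, hdiv⟩ := exists_reach_diagonal hH h2 m 0 (by omega) A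
  obtain ⟨P, Q, hP, hQ, rfl⟩ := hAB.exists_mul_mul_eq
  exact ⟨P, Q, hP, hQ,
    ⟨fun i j => hdiag i j (Nat.zero_le _) (Nat.zero_le _),
      fun i j i' j' h h' h'' => (hdiv i j i' j' (Nat.zero_le _) h h' h'').1⟩,
    fun i j i' j' h h' h'' => (hdiv i j i' j' (Nat.zero_le _) h h' h'').2⟩

lemma EDKProp.twoByTwoReduction (h : EDKProp R) : TwoByTwoReduction R := by
  intro A
  obtain ⟨_, _, ⟨P, rfl⟩, ⟨Q, rfl⟩, ⟨hdiag, hdiv⟩, hduo⟩ := h 2 2 A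
  obtain ⟨D, hD⟩ : ∃ D, D = (P : Matrix (Fin 2) (Fin 2) R) * A * Q := ⟨_, rfl⟩
  rw [← hD] at hdiag hdiv hduo
  have hA : A = (↑P⁻¹ : Matrix (Fin 2) (Fin 2) R) * D * (↑Q⁻¹ : Matrix (Fin 2) (Fin 2) R) := by
    rw [hD]
    simp [← mul_assoc]
  have h01 : D 0 1 = 0 := hdiag 0 1 (by simp)
  have h10 : D 1 0 = 0 := hdiag 1 0 (by simp)
  by_cases h1 : D 1 1 = 0
  · refine ⟨0, D 0 0, ⟨(↑P⁻¹ : Matrix (Fin 2) (Fin 2) R) * !![0, 1; 1, 0],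
      !![0, 1; 1, 0] * (↑Q⁻¹ : Matrix (Fin 2) (Fin 2) R), (Units.isUnit _).mul isUnit_swap,
      isUnit_swap.mul (Units.isUnit _), ?_⟩, .inr rfl⟩
    have hswap : (!![0, 1; 1, 0] : Matrix (Fin 2) (Fin 2) R) * Matrix.of ![![0, 0], ![0, D 0 0]] *
        !![0, 1; 1, 0] = D := by
      ext i j
      fin_cases i <;> fin_cases j <;> simp [Matrix.mul_apply, Fin.sum_univ_two, h01, h10, h1]
    rw [hA]
    nth_rw 1 [← hswap]
    simp only [Matrix.mul_assoc]
  · refine ⟨D 0 0, D 1 1, ⟨_, _, Units.isUnit P⁻¹, Units.isUnit Q⁻¹, ?_⟩, .inl ⟨?_, ?_⟩⟩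
    · have hdiagD : Matrix.of ![![D 0 0, 0], ![0, D 1 1]] = D := by
        ext i j
        fin_cases i <;> fin_cases j <;> simp [h01, h10]
      rw [hdiagD]
      exact hA
    · exact fun x hx => (hdiv 0 0 1 1 rfl rfl rfl x hx).1
    · exact (hduo 0 0 1 1 rfl rfl rfl h1).2

end Diagonal

/-- A Hermite ring has the EDK-property iff every `2 × 2` matrix is
equivalent to `diag(ε, a)` with either `RaR ⊆ εR = Rε` or `ε = 0`. -/
theorem stmt4 {R : Type*} [Ring R] [Nontrivial R] (hH : IsHermiteRing R) :
    EDKProp R ↔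
      ∀ A : Matrix (Fin 2) (Fin 2) R,
        ∃ ε a : R,
          MatEquiv A (Matrix.of ![![ε, 0], ![0, a]]) ∧
          (((∀ x ∈ TwoSidedIdeal.span {a}, ∃ r, x = ε * r) ∧
              ∀ x : R, (∃ r, x = ε * r) ↔ ∃ s, x = s * ε) ∨
            ε = 0) :=
  ⟨EDKProp.twoByTwoReduction, EDKProp.of_twoByTwoReduction hH⟩
end

section
/- Let R be a ring of stable range 1 and let a ∈ R be a 2-simple element. Then the 2×2 matrix diag(a, a) is equivalent to diag(1, Δ) for some Δ ∈ R. -/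
open Matrix

/-- A ring of stable range `1` is Dedekind-finite. -/
theorem StableRangeOne.mul_eq_one_symm {R : Type*} [Ring R] (hS : StableRangeOne R) {a b : R}
    (h : a * b = 1) : b * a = 1 := by
  obtain ⟨t, u, htu⟩ := hS b (1 - b * a) ⟨a, 1, by simp⟩
  have hw : a * (b + (1 - b * a) * t) = 1 := by
    calc a * (b + (1 - b * a) * t) = a * b + (a - (a * b) * a) * t := by noncomm_ring
      _ = 1 := by simp [h]
  have hau : a = u := left_inv_eq_right_inv hw htu
  have hb : b + (1 - b * a) * t = b := by
    subst hau
    exact left_inv_eq_right_inv htu h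
  rwa [hb, ← hau] at htu

/-- Over a ring of stable range `1`, a right unimodular row is the first row of an
invertible matrix. -/
theorem StableRangeOne.exists_isUnit_row {R : Type*} [Ring R] (hS : StableRangeOne R) {p q : R}
    (h : ∃ x y, p * x + q * y = 1) :
    ∃ X : Matrix (Fin 2) (Fin 2) R, IsUnit X ∧ X 0 0 = p ∧ X 0 1 = q := by
  obtain ⟨t, w, hw⟩ := hS p q h
  have hw' := hS.mul_eq_one_symm hw
  let U : (Matrix (Fin 2) (Fin 2) R)ˣ :=
    { val := !![p + q * t, q; 0, 1]
      inv := !![w, -(w * q); 0, 1]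
      val_inv := by simp [Matrix.one_fin_two, ← mul_assoc, hw]
      inv_val := by simp [Matrix.one_fin_two, hw'] }
  let L : (Matrix (Fin 2) (Fin 2) R)ˣ :=
    { val := !![1, 0; -t, 1]
      inv := !![1, 0; t, 1]
      val_inv := by simp [Matrix.one_fin_two]
      inv_val := by simp [Matrix.one_fin_two] }
  exact ⟨_, (U * L).isUnit, by simp [U, L], by simp [U, L]⟩

/-- In a ring of stable range 1, for a 2-simple element `a` the matrix
`diag(a, a)` is equivalent to `diag(1, Δ)` for some `Δ`. -/
theorem stmt7 {R : Type*} [Ring R] [Nontrivial R]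
    (hS : StableRangeOne R) (a : R) (ha : TwoSimple a) :
    ∃ Δ : R,
      MatEquiv (Matrix.of ![![a, 0], ![0, a]]) (Matrix.of ![![1, 0], ![0, Δ]]) := by
  obtain ⟨⟨u₁, v₁, u₂, v₂, h⟩, -⟩ := ha
  obtain ⟨_, ⟨P, rfl⟩, hP₀, hP₁⟩ := hS.exists_isUnit_row (p := u₁) (q := u₂)
    ⟨a * v₁, a * v₂, by simpa only [mul_assoc] using h⟩
  obtain ⟨_, ⟨X, rfl⟩, hX₀, hX₁⟩ := hS.exists_isUnit_row (p := u₁ * a) (q := u₂ * a) ⟨v₁, v₂, h⟩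
  set A : Matrix (Fin 2) (Fin 2) R := Matrix.of ![![a, 0], ![0, a]] with hA
  set M := P.val * A * X⁻¹.val with hM
  have hrow : (P.val * A) 0 = X.val 0 := by
    ext j
    fin_cases j <;> simp [hA, Matrix.mul_apply, hP₀, hP₁, hX₀, hX₁]
  have hM₀ (j : Fin 2) : M 0 j = (1 : Matrix (Fin 2) (Fin 2) R) 0 j := by
    rw [← X.mul_inv, hM, Matrix.mul_apply, Matrix.mul_apply, hrow]
  let L : (Matrix (Fin 2) (Fin 2) R)ˣ :=
    { val := !![1, 0; M 1 0, 1]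
      inv := !![1, 0; -M 1 0, 1]
      val_inv := by simp [Matrix.one_fin_two]
      inv_val := by simp [Matrix.one_fin_two] }
  have hLM : L.val * Matrix.of ![![1, 0], ![0, M 1 1]] = M := by
    ext i j
    fin_cases i <;> fin_cases j <;> simp [L, Matrix.mul_apply, hM₀]
  refine ⟨M 1 1, (P⁻¹ * L).val, X, (P⁻¹ * L).isUnit, X.isUnit, ?_⟩
  rw [Units.val_mul, mul_assoc P⁻¹.val, hLM, hM]
  simp [mul_assoc]
end

section
/- Let R be a domain with the D-property. If R has the L-property, i.e. RaR = R implies that a is a unit of R, then R is a duo domain: aR = Ra for every a ∈ R. -/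
open Matrix

/-- If `Rb ⊆ bR`, then the two-sided ideal generated by `b * c` is contained in `b · RcR`. -/
theorem exists_mul_of_mem_span_mul_left {R : Type*} [Ring R] {b c x : R}
    (hb : ∀ s, ∃ r, s * b = b * r) (hx : x ∈ TwoSidedIdeal.span {b * c}) :
    ∃ y ∈ TwoSidedIdeal.span {c}, x = b * y := by
  induction hx using TwoSidedIdeal.span_induction with
  | mem x hx => exact ⟨c, TwoSidedIdeal.subset_span rfl, hx⟩
  | zero => exact ⟨0, TwoSidedIdeal.zero_mem _, (mul_zero b).symm⟩
  | add x y _ _ hx hy =>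
    obtain ⟨u, hu, rfl⟩ := hx
    obtain ⟨v, hv, rfl⟩ := hy
    exact ⟨u + v, TwoSidedIdeal.add_mem _ hu hv, (mul_add b u v).symm⟩
  | neg x _ hx =>
    obtain ⟨u, hu, rfl⟩ := hx
    exact ⟨-u, TwoSidedIdeal.neg_mem _ hu, (mul_neg b u).symm⟩
  | left_absorb r x _ hx =>
    obtain ⟨u, hu, rfl⟩ := hx
    obtain ⟨t, ht⟩ := hb r
    exact ⟨t * u, TwoSidedIdeal.mul_mem_left _ t u hu, by rw [← mul_assoc, ht, mul_assoc]⟩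
  | right_absorb r x _ hx =>
    obtain ⟨u, hu, rfl⟩ := hx
    exact ⟨u * r, TwoSidedIdeal.mul_mem_right _ u r hu, mul_assoc b u r⟩

/-- If `bR ⊆ Rb`, then the two-sided ideal generated by `c * b` is contained in `RcR · b`. -/
theorem exists_mul_of_mem_span_mul_right {R : Type*} [Ring R] {b c x : R}
    (hb : ∀ r, ∃ s, b * r = s * b) (hx : x ∈ TwoSidedIdeal.span {c * b}) :
    ∃ y ∈ TwoSidedIdeal.span {c}, x = y * b := by
  induction hx using TwoSidedIdeal.span_induction with
  | mem x hx => exact ⟨c, TwoSidedIdeal.subset_span rfl, hx⟩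
  | zero => exact ⟨0, TwoSidedIdeal.zero_mem _, (zero_mul b).symm⟩
  | add x y _ _ hx hy =>
    obtain ⟨u, hu, rfl⟩ := hx
    obtain ⟨v, hv, rfl⟩ := hy
    exact ⟨u + v, TwoSidedIdeal.add_mem _ hu hv, (add_mul u v b).symm⟩
  | neg x _ hx =>
    obtain ⟨u, hu, rfl⟩ := hx
    exact ⟨-u, TwoSidedIdeal.neg_mem _ hu, (neg_mul u b).symm⟩
  | left_absorb r x _ hx =>
    obtain ⟨u, hu, rfl⟩ := hx
    exact ⟨r * u, TwoSidedIdeal.mul_mem_left _ r u hu, (mul_assoc r u b).symm⟩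
  | right_absorb r x _ hx =>
    obtain ⟨u, hu, rfl⟩ := hx
    obtain ⟨t, ht⟩ := hb r
    exact ⟨u * t, TwoSidedIdeal.mul_mem_right _ u t hu, by rw [mul_assoc, ht, mul_assoc]⟩

/-- A domain with the D-property and the L-property is a duo domain. -/
theorem stmt8 {R : Type*} [Ring R] [IsDomain R]
    (hD : DProp R)
    (hL : ∀ a : R, TwoSidedIdeal.span {a} = ⊤ → IsUnit a) :
    ∀ a x : R, (∃ r, x = a * r) ↔ ∃ s, x = s * a := by
  intro a x
  rcases eq_or_ne a 0 with rfl | ha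
  · simp
  obtain ⟨b, hspan, hduo⟩ := hD a
  have haspan : a ∈ TwoSidedIdeal.span {a} := TwoSidedIdeal.subset_span rfl
  have hbspan : b ∈ TwoSidedIdeal.span {a} := (hspan b).2 ⟨1, (mul_one b).symm⟩
  obtain ⟨c, hc⟩ := (hspan a).1 haspan
  obtain ⟨d, hd⟩ := (hduo a).1 ⟨c, hc⟩
  have hb : b ≠ 0 := by
    rintro rfl
    exact ha (hc.trans (zero_mul c))
  have hcu : IsUnit c := by
    refine hL c ((TwoSidedIdeal.one_mem_iff _).1 ?_)
    obtain ⟨y, hy, hby⟩ := exists_mul_of_mem_span_mul_left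
      (fun s => (hduo (s * b)).2 ⟨s, rfl⟩) (hc ▸ hbspan)
    rwa [mul_left_cancel₀ hb ((mul_one b).trans hby)]
  have hdu : IsUnit d := by
    refine hL d ((TwoSidedIdeal.one_mem_iff _).1 ?_)
    obtain ⟨y, hy, hby⟩ := exists_mul_of_mem_span_mul_right
      (fun r => (hduo (b * r)).1 ⟨r, rfl⟩) (hd ▸ hbspan)
    rwa [mul_right_cancel₀ hb ((one_mul b).trans hby)]
  have hright : (∃ r, x = a * r) ↔ ∃ r, x = b * r := by
    obtain ⟨u, rfl⟩ := hcu
    constructor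
    · rintro ⟨r, rfl⟩
      exact ⟨u * r, by rw [hc, mul_assoc]⟩
    · rintro ⟨r, rfl⟩
      exact ⟨↑u⁻¹ * r, by rw [hc, mul_assoc, Units.mul_inv_cancel_left]⟩
  have hleft : (∃ s, x = s * a) ↔ ∃ s, x = s * b := by
    obtain ⟨u, rfl⟩ := hdu
    constructor
    · rintro ⟨s, rfl⟩
      exact ⟨s * u, by rw [hd, mul_assoc]⟩
    · rintro ⟨s, rfl⟩
      exact ⟨s * ↑u⁻¹, by rw [hd, ← mul_assoc, Units.inv_mul_cancel_right]⟩
  exact hright.trans ((hduo x).trans hleft.symm)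
end

section
/- Let R be a Bézout domain of stable range 1 with the DK-property. If every a ∈ R with RaR = R is a finite element, then R is an elementary divisor ring. -/
open Matrix

section Helpers

variable {R : Type*} [Ring R]

/-! ### Elementary operations -/

section Operations

variable {ι κ : Type*} [Fintype ι] [Fintype κ] [DecidableEq ι] [DecidableEq κ]

/-- Equivalence of matrices over arbitrary finite index types. -/
def EquivMat (A B : Matrix ι κ R) : Prop :=
  ∃ (P : Matrix ι ι R) (Q : Matrix κ κ R), IsUnit P ∧ IsUnit Q ∧ B = P * A * Q

theorem EquivMat.refl (A : Matrix ι κ R) : EquivMat A A :=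
  ⟨1, 1, isUnit_one, isUnit_one, by simp⟩

theorem EquivMat.trans {A B C : Matrix ι κ R} (h : EquivMat A B) (h' : EquivMat B C) :
    EquivMat A C := by
  obtain ⟨P, Q, hP, hQ, rfl⟩ := h
  obtain ⟨P', Q', hP', hQ', rfl⟩ := h'
  exact ⟨P' * P, Q * Q', hP'.mul hP, hQ.mul hQ', by simp only [Matrix.mul_assoc]⟩

theorem EquivMat.mul_right (A : Matrix ι κ R) {Q : Matrix κ κ R} (hQ : IsUnit Q) :
    EquivMat A (A * Q) :=
  ⟨1, Q, isUnit_one, hQ, by simp⟩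

theorem EquivMat.mul_left (A : Matrix ι κ R) {P : Matrix ι ι R} (hP : IsUnit P) :
    EquivMat A (P * A) :=
  ⟨P, 1, hP, isUnit_one, by simp⟩

theorem isUnit_one_add_vecMulVec (u v : κ → R) (h : v ⬝ᵥ u = 0) :
    IsUnit (1 + vecMulVec u v) := by
  have hN : vecMulVec u v * vecMulVec u v = 0 := by
    rw [vecMulVec_mul_vecMulVec, h]
    ext i j
    simp [vecMulVec_apply]
  refine ⟨⟨1 + vecMulVec u v, 1 - vecMulVec u v, ?_, ?_⟩, rfl⟩ <;>
    simp [mul_sub, sub_mul, mul_add, add_mul, hN]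

end Operations

/-- Adding right multiples of one column to the other columns. -/
theorem exists_colAdd {ι κ : Type*} [Fintype κ] [DecidableEq κ] (j₀ : κ) (w : κ → R) (hw : w j₀ = 0) :
    ∃ Q : Matrix κ κ R, IsUnit Q ∧
      ∀ (A : Matrix ι κ R) i k, (A * Q) i k = A i k + A i j₀ * w k := by
  refine ⟨1 + vecMulVec (Pi.single j₀ 1) w, isUnit_one_add_vecMulVec _ _ (by simp [hw]), ?_⟩
  intro A i k
  rw [Matrix.mul_add, Matrix.mul_one, mul_vecMulVec, Matrix.add_apply, vecMulVec_apply]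
  simp

/-- Adding left multiples of one row to the other rows. -/
theorem exists_rowAdd {ι κ : Type*} [Fintype ι] [DecidableEq ι] (i₀ : ι) (w : ι → R) (hw : w i₀ = 0) :
    ∃ P : Matrix ι ι R, IsUnit P ∧
      ∀ (A : Matrix ι κ R) i k, (P * A) i k = A i k + w i * A i₀ k := by
  refine ⟨1 + vecMulVec w (Pi.single i₀ 1), isUnit_one_add_vecMulVec _ _ (by simp [hw]), ?_⟩
  intro A i k
  rw [Matrix.add_mul, Matrix.one_mul, vecMulVec_mul, Matrix.add_apply, vecMulVec_apply]
  simp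

/-! ### Stable range one in a Bézout domain -/

theorem StableRangeOne.isUnit [IsDomain R] (hS : StableRangeOne R) {a b x y : R}
    (h : a * x + b * y = 1) : ∃ t, IsUnit (a + b * t) := by
  obtain ⟨t, u, h⟩ := hS a b ⟨x, y, h⟩
  exact ⟨t, .of_mul_eq_one u h⟩

theorem StableRangeOne.isUnit_left [IsDomain R] (hS : StableRangeOne R) {a b x y : R}
    (h : x * a + y * b = 1) : ∃ t, IsUnit (a + t * b) := by
  obtain ⟨t, u, hu⟩ := hS.isUnit (a := x) (b := y * b) (x := a) (y := 1) (by simpa using h)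
  have hyb : y * b = 1 - x * a := eq_sub_of_add_eq' h
  set v : R := ((u⁻¹ : Rˣ) : R) with hv
  have huv : (x + y * b * t) * v = 1 := by rw [← hu, hv, Units.mul_inv]
  rw [hyb] at huv
  refine ⟨(1 - a * t) * v * y, .of_mul_eq_one_right (t + (1 - t * a) * x) ?_⟩
  have e1 : a + (1 - a * t) * v * y * b = a + (1 - a * t) * v * (1 - x * a) := by
    rw [mul_assoc _ y b, hyb]
  have e2 : x * (1 - a * t) * v = 1 - t * v := by
    refine eq_sub_of_add_eq (Eq.trans ?_ huv)
    noncomm_ring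
  have e3 : x * (a + (1 - a * t) * v * (1 - x * a)) = 1 - t * v * (1 - x * a) := by
    calc _ = x * a + x * (1 - a * t) * v * (1 - x * a) := by noncomm_ring
      _ = _ := by rw [e2]; noncomm_ring
  have e4 : t * (a + (1 - a * t) * v * (1 - x * a)) =
      t * a + (1 - t * a) * (t * v * (1 - x * a)) := by noncomm_ring
  rw [e1, add_mul, mul_assoc _ x, e3, e4]
  noncomm_ring

/-- Some `a + b t` generates the right ideal `aR + bR`. -/
theorem IsBezoutRing.exists_add_mul [IsDomain R] (hB : IsBezoutRing R) (hS : StableRangeOne R)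
    (a b : R) : ∃ t s, b = (a + b * t) * s := by
  obtain ⟨d, hd⟩ := hB.1 (Ideal.span {MulOpposite.op a, MulOpposite.op b})
    (Submodule.fg_span (Set.toFinite _))
  obtain ⟨a', ha⟩ := Ideal.mem_span_singleton'.1
    (hd ▸ Ideal.subset_span (by simp) : MulOpposite.op a ∈ Ideal.span {d})
  obtain ⟨b', hb⟩ := Ideal.mem_span_singleton'.1
    (hd ▸ Ideal.subset_span (by simp) : MulOpposite.op b ∈ Ideal.span {d})
  obtain ⟨x, y, hxy⟩ := Ideal.mem_span_pair.1
    (hd ▸ Ideal.subset_span (by simp) : d ∈ Ideal.span {MulOpposite.op a, MulOpposite.op b})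
  replace ha : d.unop * a'.unop = a := congrArg MulOpposite.unop ha
  replace hb : d.unop * b'.unop = b := congrArg MulOpposite.unop hb
  replace hxy : a * x.unop + b * y.unop = d.unop := congrArg MulOpposite.unop hxy
  by_cases h0 : d.unop = 0
  · refine ⟨0, 0, ?_⟩
    simp [← hb, h0]
  have h1 : a'.unop * x.unop + b'.unop * y.unop = 1 := by
    apply mul_left_cancel₀ h0
    rw [mul_add, ← mul_assoc, ← mul_assoc, ha, hb, hxy, mul_one]
  obtain ⟨t, u, hu⟩ := hS.isUnit h1
  refine ⟨t, ((u⁻¹ : Rˣ) : R) * b'.unop, ?_⟩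
  rw [← ha, ← hb, mul_assoc _ _ t, ← mul_add, ← hu, mul_assoc, Units.mul_inv_cancel_left]

/-- Some `a + t b` generates the left ideal `Ra + Rb`. -/
theorem IsBezoutRing.exists_add_mul_left [IsDomain R] (hB : IsBezoutRing R)
    (hS : StableRangeOne R) (a b : R) : ∃ t s, b = s * (a + t * b) := by
  obtain ⟨d, hd⟩ := hB.2 (Ideal.span {a, b}) (Submodule.fg_span (Set.toFinite _))
  obtain ⟨a', ha⟩ := Ideal.mem_span_singleton'.1
    (hd ▸ Ideal.subset_span (by simp) : a ∈ Ideal.span {d})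
  obtain ⟨b', hb⟩ := Ideal.mem_span_singleton'.1
    (hd ▸ Ideal.subset_span (by simp) : b ∈ Ideal.span {d})
  obtain ⟨x, y, hxy⟩ := Ideal.mem_span_pair.1
    (hd ▸ Ideal.subset_span (by simp) : d ∈ Ideal.span {a, b})
  by_cases h0 : d = 0
  · refine ⟨0, 0, ?_⟩
    simp [← hb, h0]
  have h1 : x * a' + y * b' = 1 := by
    apply mul_right_cancel₀ h0
    rw [add_mul, mul_assoc, mul_assoc, ha, hb, hxy, one_mul]
  obtain ⟨t, u, hu⟩ := hS.isUnit_left h1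
  refine ⟨t, b' * ((u⁻¹ : Rˣ) : R), ?_⟩
  rw [← ha, ← hb, ← mul_assoc t, ← add_mul, ← hu, mul_assoc, Units.inv_mul_cancel_left]

/-! ### Descent along divisors of a finite element -/

theorem wellFoundedGT_ideal_of_mem (x : R) (hx : ∀ I : Ideal R, x ∈ I → ∃ d, I = Ideal.span {d}) :
    WellFoundedGT {I : Ideal R // x ∈ I} := by
  let N : Submodule R R := Submodule.span R {x}
  have hxN : x ∈ N := Submodule.mem_span_singleton_self x
  have hN : IsNoetherian R (R ⧸ N) := by
    refine isNoetherian_def.2 fun M => ?_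
    have hfg : (M.comap N.mkQ).FG := by
      obtain ⟨d, hd⟩ := hx (M.comap N.mkQ) (by
        have : N.mkQ x = 0 := (Submodule.Quotient.mk_eq_zero N).2 hxN
        rw [Submodule.mem_comap, this]
        exact M.zero_mem)
      rw [hd]
      exact Submodule.fg_span_singleton d
    have := hfg.map N.mkQ
    rwa [Submodule.map_comap_eq_of_surjective N.mkQ_surjective] at this
  let f : {I : Ideal R // x ∈ I} → Submodule R (R ⧸ N) := fun I => Submodule.map N.mkQ I.1
  have hle : ∀ I, (f I).comap N.mkQ = I.1 := fun I => by
    simp only [f]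
    rw [Submodule.comap_map_mkQ, sup_eq_right, Submodule.span_le]
    simpa using I.2
  have hf : StrictMono f := by
    intro I J h
    refine lt_of_le_not_ge (Submodule.map_mono (Subtype.coe_le_coe.2 h.le)) fun h' => h.not_ge ?_
    have := Submodule.comap_mono (f := N.mkQ) h'
    rwa [hle, hle] at this
  exact hf.wellFoundedGT

/-- Induction along proper left and right factors of a finite element. -/
theorem FiniteElem.induction [IsDomain R] {x : R} (hx : FiniteElem x) (C : R → Prop)
    (h : ∀ y, (∀ y' s, y = y' * s → ¬ IsUnit s → C y') →
      (∀ y' s, y = s * y' → ¬ IsUnit s → C y') → C y) : C x := by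
  obtain ⟨hx0, hr, hl⟩ := hx
  have := wellFoundedGT_ideal_of_mem x hl
  have := wellFoundedGT_ideal_of_mem (MulOpposite.op x) hr
  suffices H : ∀ (a : {I : Ideal R // x ∈ I} × {I : Ideal Rᵐᵒᵖ // MulOpposite.op x ∈ I})
      (p y q : R), x = p * y * q → a.1.1 = Ideal.span {y * q} →
        a.2.1 = Ideal.span {MulOpposite.op (p * y)} → C y by
    refine H (⟨Ideal.span {x}, Ideal.mem_span_singleton_self x⟩,
      ⟨Ideal.span {MulOpposite.op x}, Ideal.mem_span_singleton_self _⟩) 1 x 1 ?_ ?_ ?_ <;> simp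
  intro a
  induction a using WellFoundedGT.induction with
  | ind a ih =>
  intro p y q hxy h1 h2
  have memL : ∀ p y q : R, x = p * y * q → x ∈ Ideal.span {y * q} := fun p y q h =>
    Ideal.mem_span_singleton'.2 ⟨p, by rw [h, mul_assoc]⟩
  have memR : ∀ p y q : R, x = p * y * q →
      MulOpposite.op x ∈ Ideal.span {MulOpposite.op (p * y)} := fun p y q h =>
    Ideal.mem_span_singleton'.2 ⟨MulOpposite.op q, by rw [h, ← MulOpposite.op_mul]⟩
  refine h y (fun y' s hy hs => ?_) (fun y' s hy hs => ?_)
  · have hx' : x = p * y' * (s * q) := by rw [hxy, hy]; simp only [mul_assoc]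
    have hne : p * y' ≠ 0 := fun h0 => hx0 (by rw [hx', h0, zero_mul])
    refine ih (⟨_, memL _ _ _ hx'⟩, ⟨_, memR _ _ _ hx'⟩) ?_ p y' (s * q) hx' rfl rfl
    refine Prod.lt_iff.2 (Or.inr ⟨?_, lt_of_le_not_ge ?_ fun hge => hs ?_⟩)
    · change a.1.1 ≤ Ideal.span {y' * (s * q)}
      rw [h1, hy, mul_assoc]
    · change a.2.1 ≤ Ideal.span {MulOpposite.op (p * y')}
      rw [h2, Ideal.span_le, Set.singleton_subset_iff]
      exact Ideal.mem_span_singleton'.2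
        ⟨MulOpposite.op s, by rw [hy, ← MulOpposite.op_mul, mul_assoc]⟩
    · change Ideal.span {MulOpposite.op (p * y')} ≤ a.2.1 at hge
      rw [h2, Ideal.span_le, Set.singleton_subset_iff] at hge
      obtain ⟨r, hr⟩ := Ideal.mem_span_singleton'.1 hge
      replace hr : p * y * r.unop = p * y' := congrArg MulOpposite.unop hr
      refine .of_mul_eq_one r.unop (mul_left_cancel₀ hne ?_)
      rw [mul_one, ← mul_assoc, mul_assoc p, ← hy, hr]
  · have hx' : x = (p * s) * y' * q := by rw [hxy, hy]; simp only [mul_assoc]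
    have hne : y' * q ≠ 0 := fun h0 => hx0 (by rw [hx', mul_assoc, h0, mul_zero])
    refine ih (⟨_, memL _ _ _ hx'⟩, ⟨_, memR _ _ _ hx'⟩) ?_ (p * s) y' q hx' rfl rfl
    refine Prod.lt_iff.2 (Or.inl ⟨lt_of_le_not_ge ?_ fun hge => hs ?_, ?_⟩)
    · change a.1.1 ≤ Ideal.span {y' * q}
      rw [h1, Ideal.span_le, Set.singleton_subset_iff]
      exact Ideal.mem_span_singleton'.2 ⟨s, by rw [hy, mul_assoc]⟩
    · change Ideal.span {y' * q} ≤ a.1.1 at hge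
      rw [h1, Ideal.span_le, Set.singleton_subset_iff] at hge
      obtain ⟨r, hr⟩ := Ideal.mem_span_singleton'.1 hge
      refine .of_mul_eq_one_right r (mul_right_cancel₀ hne ?_)
      rw [one_mul, mul_assoc, ← mul_assoc s, ← hy, hr]
    · change a.2.1 ≤ Ideal.span {MulOpposite.op (p * s * y')}
      rw [h2, hy, mul_assoc]

/-! ### Total divisibility -/

/-- `a` is a total divisor of `b`, i.e. `RbR ⊆ aR ∩ Ra`. -/
def TotalDvd (a b : R) : Prop :=
  ∀ r, (∃ s, r * b = a * s) ∧ ∃ s, b * r = s * a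

namespace TotalDvd

variable {a b c : R}

theorem zero (a : R) : TotalDvd a 0 := fun _ => ⟨⟨0, by simp⟩, ⟨0, by simp⟩⟩

theorem add (hb : TotalDvd a b) (hc : TotalDvd a c) : TotalDvd a (b + c) := fun r => by
  obtain ⟨⟨s, hs⟩, s', hs'⟩ := hb r
  obtain ⟨⟨t, ht⟩, t', ht'⟩ := hc r
  exact ⟨⟨s + t, by rw [mul_add, mul_add, hs, ht]⟩, ⟨s' + t', by rw [add_mul, add_mul, hs', ht']⟩⟩

theorem sum {α : Type*} (s : Finset α) (f : α → R) (h : ∀ i ∈ s, TotalDvd a (f i)) :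
    TotalDvd a (∑ i ∈ s, f i) :=
  Finset.sum_induction f _ (fun _ _ => add) (zero a) h

theorem mul_left (c : R) (hb : TotalDvd a b) : TotalDvd a (c * b) := fun r => by
  obtain ⟨s, hs⟩ := (hb (r * c)).1
  obtain ⟨t, ht⟩ := (hb r).2
  exact ⟨⟨s, by rw [← mul_assoc, hs]⟩, ⟨c * t, by rw [mul_assoc, ht, mul_assoc]⟩⟩

theorem mul_right (c : R) (hb : TotalDvd a b) : TotalDvd a (b * c) := fun r => by
  obtain ⟨s, hs⟩ := (hb r).1
  obtain ⟨t, ht⟩ := (hb (c * r)).2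
  exact ⟨⟨s * c, by rw [← mul_assoc, hs, mul_assoc]⟩, ⟨t, by rw [mul_assoc, ht]⟩⟩

theorem of_mem_span (hb : TotalDvd a b) {x : R} (hx : x ∈ TwoSidedIdeal.span {b}) :
    TotalDvd a x := by
  induction hx using TwoSidedIdeal.span_induction with
  | mem x h => rwa [Set.mem_singleton_iff.1 h]
  | zero => exact zero a
  | add x y _ _ hx hy => exact hx.add hy
  | neg x _ hx => simpa using hx.mul_left (-1)
  | left_absorb c x _ hx => exact hx.mul_left c
  | right_absorb c x _ hx => exact hx.mul_right c

theorem iff_span : TotalDvd a b ↔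
    ∀ x ∈ TwoSidedIdeal.span {b}, (∃ r, x = a * r) ∧ ∃ s, x = s * a := by
  refine ⟨fun h x hx => ?_, fun h r => ?_⟩
  · simpa using h.of_mem_span hx 1
  · have hb : b ∈ TwoSidedIdeal.span {b} := TwoSidedIdeal.subset_span rfl
    exact ⟨(h _ (TwoSidedIdeal.mul_mem_left _ r b hb)).1,
      (h _ (TwoSidedIdeal.mul_mem_right _ b r hb)).2⟩

theorem smul_of_normal {d : R} (h₁ : ∀ r, ∃ s, r * d = d * s) (h₂ : ∀ r, ∃ s, d * r = s * d)
    (h : TotalDvd a b) : TotalDvd (d * a) (d * b) := fun r => by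
  obtain ⟨r', hr'⟩ := h₁ r
  obtain ⟨s, hs⟩ := (h r').1
  obtain ⟨t, ht⟩ := (h r).2
  obtain ⟨t', ht'⟩ := h₂ t
  exact ⟨⟨s, by rw [← mul_assoc, hr', mul_assoc, hs, mul_assoc]⟩,
    ⟨t', by rw [mul_assoc, ht, ← mul_assoc, ht', mul_assoc]⟩⟩

end TotalDvd

theorem isTotalDivisorDiag_iff {m n : ℕ} {D : Matrix (Fin m) (Fin n) R} :
    IsTotalDivisorDiag D ↔
      (∀ (i : Fin m) (j : Fin n), (i : ℕ) ≠ (j : ℕ) → D i j = 0) ∧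
      ∀ (i : Fin m) (j : Fin n) (i' : Fin m) (j' : Fin n),
        (i : ℕ) = (j : ℕ) → (i' : ℕ) = (j' : ℕ) → (i' : ℕ) = (i : ℕ) + 1 →
        TotalDvd (D i j) (D i' j') := by
  simp only [IsTotalDivisorDiag, TotalDvd.iff_span]

/-! ### Making one entry generate the two-sided ideal of all entries -/

theorem exists_row_reduce {ι κ : Type*} [Fintype κ] [DecidableEq κ]
    (hr : ∀ a b : R, ∃ t s, b = (a + b * t) * s) (A : Matrix ι κ R)
    (i : ι) (j₀ : κ) : ∃ Q : Matrix κ κ R, IsUnit Q ∧ ∀ j ≠ j₀, (A * Q) i j = 0 := by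
  suffices H : ∀ S : Finset κ, ∃ Q : Matrix κ κ R, IsUnit Q ∧
      ∀ j ∈ S, j ≠ j₀ → (A * Q) i j = 0 by
    obtain ⟨Q, hQ, h⟩ := H Finset.univ
    exact ⟨Q, hQ, fun j => h j (Finset.mem_univ j)⟩
  intro S
  induction S using Finset.induction_on with
  | empty => exact ⟨1, isUnit_one, by simp⟩
  | insert k S _ ih =>
    obtain ⟨Q, hQ, h⟩ := ih
    by_cases hk : k = j₀
    · refine ⟨Q, hQ, fun j hj hj₀ => h j ?_ hj₀⟩
      exact (Finset.mem_insert.1 hj).resolve_left fun e => hj₀ (e.trans hk)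
    obtain ⟨t, s, hts⟩ := hr ((A * Q) i j₀) ((A * Q) i k)
    obtain ⟨Q₁, hQ₁, h₁⟩ := exists_colAdd (ι := ι) k (Pi.single j₀ t) (by simp [hk])
    obtain ⟨Q₂, hQ₂, h₂⟩ := exists_colAdd (ι := ι) j₀ (Pi.single k (-s)) (by simp [Ne.symm hk])
    refine ⟨Q * Q₁ * Q₂, (hQ.mul hQ₁).mul hQ₂, fun j hj hj₀ => ?_⟩
    rw [← Matrix.mul_assoc, ← Matrix.mul_assoc, h₂, h₁, h₁]
    by_cases hjk : j = k
    · subst hjk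
      simp [hj₀, ← hts]
    · simp [hj₀, hjk, h j ((Finset.mem_insert.1 hj).resolve_left hjk) hj₀]

/-- The two-sided ideal generated by a row. -/
def rowIdeal {ι κ : Type*} (A : Matrix ι κ R) (i : ι) : TwoSidedIdeal R :=
  TwoSidedIdeal.span (Set.range (A i))

theorem mem_rowIdeal {ι κ : Type*} (A : Matrix ι κ R) (i : ι) (j : κ) : A i j ∈ rowIdeal A i :=
  TwoSidedIdeal.subset_span ⟨j, rfl⟩

theorem rowIdeal_le {ι κ : Type*} {A : Matrix ι κ R} {i : ι} {I : TwoSidedIdeal R} :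
    rowIdeal A i ≤ I ↔ ∀ j, A i j ∈ I := by
  rw [rowIdeal, TwoSidedIdeal.span_le, Set.range_subset_iff]
  rfl

theorem rowIdeal_mul_le {ι κ : Type*} [Fintype κ] (A : Matrix ι κ R)
    (Q : Matrix κ κ R) (i : ι) :
    rowIdeal (A * Q) i ≤ rowIdeal A i :=
  rowIdeal_le.2 fun j => by
    rw [Matrix.mul_apply]
    exact TwoSidedIdeal.finsetSum_mem _ _ _ fun k _ =>
      TwoSidedIdeal.mul_mem_right _ _ _ (mem_rowIdeal A i k)

theorem rowIdeal_mul {ι κ : Type*} [Fintype κ] [DecidableEq κ] (A : Matrix ι κ R)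
    {Q : Matrix κ κ R} (hQ : IsUnit Q) (i : ι) :
    rowIdeal (A * Q) i = rowIdeal A i := by
  refine le_antisymm (rowIdeal_mul_le A Q i) ?_
  obtain ⟨u, rfl⟩ := hQ
  have := rowIdeal_mul_le (A * (u : Matrix κ κ R)) ((u⁻¹ : (Matrix κ κ R)ˣ) : Matrix κ κ R) i
  rwa [Matrix.mul_assoc, Units.mul_inv, Matrix.mul_one] at this

section Pivot

variable {ι κ : Type*} [Fintype ι] [Fintype κ] [DecidableEq ι] [DecidableEq κ]

theorem EquivMat.apply_mem {A B : Matrix ι κ R} (h : EquivMat A B) {I : TwoSidedIdeal R}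
    (hA : ∀ i j, A i j ∈ I) (i : ι) (j : κ) : B i j ∈ I := by
  obtain ⟨P, Q, -, -, rfl⟩ := h
  simp only [Matrix.mul_apply]
  exact TwoSidedIdeal.finsetSum_mem _ _ _ fun k _ => TwoSidedIdeal.mul_mem_right _ _ _ <|
    TwoSidedIdeal.finsetSum_mem _ _ _ fun l _ => TwoSidedIdeal.mul_mem_left _ _ _ (hA l k)

theorem exists_absorb_row (hr : ∀ a b : R, ∃ t s, b = (a + b * t) * s)
    (hl : ∀ a b : R, ∃ t s, b = s * (a + t * b)) (A : Matrix ι κ R) (i₀ : ι) (j₀ : κ)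
    {k : ι} (hk : k ≠ i₀) :
    ∃ B, EquivMat A B ∧ (∀ i ≠ i₀, rowIdeal A i ≤ rowIdeal B i) ∧
      rowIdeal A i₀ ≤ rowIdeal B i₀ ∧ rowIdeal A k ≤ rowIdeal B i₀ := by
  obtain ⟨Q, hQ, h0⟩ := exists_row_reduce hr A k j₀
  obtain ⟨t, s, hts⟩ := hl ((A * Q) i₀ j₀) ((A * Q) k j₀)
  obtain ⟨P, hP, h⟩ := exists_rowAdd (κ := κ) k (Pi.single i₀ t) (by simp [hk])
  have hmem : (P * (A * Q)) i₀ j₀ ∈ rowIdeal (P * (A * Q)) i₀ := mem_rowIdeal _ _ _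
  have hk₀ : (A * Q) k j₀ ∈ rowIdeal (P * (A * Q)) i₀ := by
    rw [hts]
    refine TwoSidedIdeal.mul_mem_left _ _ _ ?_
    simpa [h] using hmem
  refine ⟨P * (A * Q), (EquivMat.mul_right A hQ).trans (EquivMat.mul_left _ hP), ?_, ?_, ?_⟩
  · intro i hi
    rw [← rowIdeal_mul A hQ, rowIdeal_le]
    intro j
    have := mem_rowIdeal (P * (A * Q)) i j
    simpa [h _ i j, hi] using this
  · rw [← rowIdeal_mul A hQ, rowIdeal_le]
    intro j
    by_cases hj : j = j₀
    · subst hj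
      have := TwoSidedIdeal.sub_mem _ hmem (TwoSidedIdeal.mul_mem_left _ t _ hk₀)
      rw [h] at this
      simpa using this
    · have := mem_rowIdeal (P * (A * Q)) i₀ j
      rw [h] at this
      simpa [h0 j hj] using this
  · rw [← rowIdeal_mul A hQ, rowIdeal_le]
    intro j
    by_cases hj : j = j₀
    · rwa [hj]
    · rw [h0 j hj]
      exact TwoSidedIdeal.zero_mem _

/-- Every matrix is equivalent to one whose chosen entry generates the two-sided ideal of
all entries. -/
theorem exists_generating_entry (hr : ∀ a b : R, ∃ t s, b = (a + b * t) * s)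
    (hl : ∀ a b : R, ∃ t s, b = s * (a + t * b)) (A : Matrix ι κ R) (i₀ : ι) (j₀ : κ) :
    ∃ B, EquivMat A B ∧ ∀ i j, B i j ∈ TwoSidedIdeal.span {B i₀ j₀} := by
  have H : ∀ S : Finset ι, ∃ B, EquivMat A B ∧ (∀ i ≠ i₀, rowIdeal A i ≤ rowIdeal B i) ∧
      rowIdeal A i₀ ≤ rowIdeal B i₀ ∧ ∀ i ∈ S, rowIdeal A i ≤ rowIdeal B i₀ := by
    intro S
    induction S using Finset.induction_on with
    | empty => exact ⟨A, .refl A, by simp⟩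
    | insert k S _ ih =>
      obtain ⟨B, hAB, h1, h2, h3⟩ := ih
      by_cases hk : k = i₀
      · exact ⟨B, hAB, h1, h2, Finset.forall_mem_insert _ _ _ |>.2 ⟨hk ▸ h2, h3⟩⟩
      · obtain ⟨C, hBC, h1', h2', h3'⟩ := exists_absorb_row hr hl B i₀ j₀ hk
        exact ⟨C, hAB.trans hBC, fun i hi => (h1 i hi).trans (h1' i hi), h2.trans h2',
          Finset.forall_mem_insert _ _ _ |>.2
            ⟨(h1 k hk).trans h3', fun i hi => (h3 i hi).trans h2'⟩⟩
  obtain ⟨B, hAB, -, -, h⟩ := H Finset.univ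
  obtain ⟨Q, hQ, h0⟩ := exists_row_reduce hr B i₀ j₀
  have hle : rowIdeal B i₀ ≤ TwoSidedIdeal.span {(B * Q) i₀ j₀} := by
    rw [← rowIdeal_mul B hQ, rowIdeal_le]
    intro j
    by_cases hj : j = j₀
    · rw [hj]
      exact TwoSidedIdeal.subset_span rfl
    · rw [h0 j hj]
      exact TwoSidedIdeal.zero_mem _
  have hAC : EquivMat A (B * Q) := hAB.trans (EquivMat.mul_right B hQ)
  exact ⟨B * Q, hAC, hAC.apply_mem fun i j =>
    hle (h i (Finset.mem_univ i) (mem_rowIdeal A i j))⟩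

/-! ### Reduction with a finite pivot -/

theorem exists_proper_right_factor (hr : ∀ a b : R, ∃ t s, b = (a + b * t) * s)
    (A : Matrix ι κ R) (i₀ : ι) (j₀ j : κ) (h : ∀ s, A i₀ j ≠ A i₀ j₀ * s) :
    ∃ B s, EquivMat A B ∧ A i₀ j₀ = B i₀ j₀ * s ∧ ¬ IsUnit s := by
  have hj : j ≠ j₀ := fun e => h 1 (by simp [e])
  obtain ⟨t, s, hts⟩ := hr (A i₀ j₀) (A i₀ j)
  obtain ⟨Q, hQ, hAQ⟩ := exists_colAdd (ι := ι) j (Pi.single j₀ t) (by simp [hj])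
  have e : (A * Q) i₀ j₀ = A i₀ j₀ + A i₀ j * t := by simp [hAQ]
  have e' : A i₀ j₀ = (A * Q) i₀ j₀ * (1 - s * t) := by
    rw [mul_sub, mul_one, ← mul_assoc, e, ← hts, add_sub_cancel_right]
  refine ⟨A * Q, 1 - s * t, EquivMat.mul_right A hQ, e', fun ⟨u, hu⟩ => ?_⟩
  refine h (((u⁻¹ : Rˣ) : R) * s) ?_
  rw [e', ← hu, mul_assoc, Units.mul_inv_cancel_left, e, ← hts]

theorem exists_proper_left_factor (hl : ∀ a b : R, ∃ t s, b = s * (a + t * b))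
    (A : Matrix ι κ R) (i₀ i : ι) (j₀ : κ) (h : ∀ s, A i j₀ ≠ s * A i₀ j₀) :
    ∃ B s, EquivMat A B ∧ A i₀ j₀ = s * B i₀ j₀ ∧ ¬ IsUnit s := by
  have hi : i ≠ i₀ := fun e => h 1 (by simp [e])
  obtain ⟨t, s, hts⟩ := hl (A i₀ j₀) (A i j₀)
  obtain ⟨P, hP, hPA⟩ := exists_rowAdd (κ := κ) i (Pi.single i₀ t) (by simp [hi])
  have e : (P * A) i₀ j₀ = A i₀ j₀ + t * A i j₀ := by simp [hPA]
  have e' : A i₀ j₀ = (1 - t * s) * (P * A) i₀ j₀ := by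
    rw [sub_mul, one_mul, mul_assoc, e, ← hts, add_sub_cancel_right]
  refine ⟨P * A, 1 - t * s, EquivMat.mul_left A hP, e', fun ⟨u, hu⟩ => ?_⟩
  refine h (s * ((u⁻¹ : Rˣ) : R)) ?_
  rw [e', ← hu, mul_assoc, Units.inv_mul_cancel_left, e, ← hts]

theorem exists_clear_cross (A : Matrix ι κ R) (i₀ : ι) (j₀ : κ)
    (h₁ : ∀ j, ∃ s, A i₀ j = A i₀ j₀ * s) (h₂ : ∀ i, ∃ s, A i j₀ = s * A i₀ j₀) :
    ∃ B, EquivMat A B ∧ B i₀ j₀ = A i₀ j₀ ∧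
      (∀ j ≠ j₀, B i₀ j = 0) ∧ ∀ i ≠ i₀, B i j₀ = 0 := by
  choose s hs using h₁
  choose t ht using h₂
  obtain ⟨Q, hQ, hAQ⟩ :=
    exists_colAdd (ι := ι) j₀ (fun j => if j = j₀ then 0 else -s j) (by simp)
  obtain ⟨P, hP, hPA⟩ :=
    exists_rowAdd (κ := κ) i₀ (fun i => if i = i₀ then 0 else -t i) (by simp)
  refine ⟨P * (A * Q), (EquivMat.mul_right A hQ).trans (EquivMat.mul_left _ hP), ?_, ?_, ?_⟩
  · simp [hPA, hAQ]
  · intro j hj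
    simp [hPA, hAQ, hj, ← hs]
  · intro i hi
    simp [hPA, hAQ, hi, ← ht]

theorem exists_pivot_totalDvd [IsDomain R] (hr : ∀ a b : R, ∃ t s, b = (a + b * t) * s)
    (hl : ∀ a b : R, ∃ t s, b = s * (a + t * b)) (A : Matrix ι κ R) (i₀ : ι) (j₀ : κ)
    (hfin : FiniteElem (A i₀ j₀)) :
    ∃ B, EquivMat A B ∧ (∀ j ≠ j₀, B i₀ j = 0) ∧ (∀ i ≠ i₀, B i j₀ = 0) ∧
      ∀ i ≠ i₀, ∀ j ≠ j₀, TotalDvd (B i₀ j₀) (B i j) := by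
  refine hfin.induction (fun x => ∀ A : Matrix ι κ R, A i₀ j₀ = x →
    ∃ B, EquivMat A B ∧ (∀ j ≠ j₀, B i₀ j = 0) ∧ (∀ i ≠ i₀, B i j₀ = 0) ∧
      ∀ i ≠ i₀, ∀ j ≠ j₀, TotalDvd (B i₀ j₀) (B i j)) ?_ A rfl
  intro x ihr ihl A hA
  have stepr : ∀ B : Matrix ι κ R, EquivMat A B → B i₀ j₀ = x →
      ∀ j, (∀ s, B i₀ j ≠ B i₀ j₀ * s) → ∃ B, EquivMat A B ∧ (∀ j ≠ j₀, B i₀ j = 0) ∧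
        (∀ i ≠ i₀, B i j₀ = 0) ∧ ∀ i ≠ i₀, ∀ j ≠ j₀, TotalDvd (B i₀ j₀) (B i j) := by
    intro B hAB hB j h
    obtain ⟨C, s, hBC, hs, hu⟩ := exists_proper_right_factor hr B i₀ j₀ j h
    obtain ⟨D, hCD, hD⟩ := ihr _ s (hB ▸ hs) hu C rfl
    exact ⟨D, (hAB.trans hBC).trans hCD, hD⟩
  have stepl : ∀ B : Matrix ι κ R, EquivMat A B → B i₀ j₀ = x →
      ∀ i, (∀ s, B i j₀ ≠ s * B i₀ j₀) → ∃ B, EquivMat A B ∧ (∀ j ≠ j₀, B i₀ j = 0) ∧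
        (∀ i ≠ i₀, B i j₀ = 0) ∧ ∀ i ≠ i₀, ∀ j ≠ j₀, TotalDvd (B i₀ j₀) (B i j) := by
    intro B hAB hB i h
    obtain ⟨C, s, hBC, hs, hu⟩ := exists_proper_left_factor hl B i₀ i j₀ h
    obtain ⟨D, hCD, hD⟩ := ihl _ s (hB ▸ hs) hu C rfl
    exact ⟨D, (hAB.trans hBC).trans hCD, hD⟩
  by_cases h1 : ∃ j, ∀ s, A i₀ j ≠ A i₀ j₀ * s
  · obtain ⟨j, hj⟩ := h1
    exact stepr A (.refl A) hA j hj
  by_cases h2 : ∃ i, ∀ s, A i j₀ ≠ s * A i₀ j₀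
  · obtain ⟨i, hi⟩ := h2
    exact stepl A (.refl A) hA i hi
  push Not at h1 h2
  obtain ⟨B, hAB, hB, hrow, hcol⟩ := exists_clear_cross A i₀ j₀ h1 h2
  by_contra hcon
  refine hcon ⟨B, hAB, hrow, hcol, fun i hi j hj r => ?_⟩
  constructor <;> by_contra! hne
  · obtain ⟨P, hP, h⟩ := exists_rowAdd (κ := κ) i (Pi.single i₀ r) (by simp [hi])
    refine hcon (stepr (P * B) (hAB.trans (EquivMat.mul_left B hP)) ?_ j fun s => ?_)
    · simp [h, hcol i hi, hB, hA]
    · simpa [h, hcol i hi, hrow j hj] using hne s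
  · obtain ⟨Q, hQ, h⟩ := exists_colAdd (ι := ι) j (Pi.single j₀ r) (by simp [hj])
    refine hcon (stepl (B * Q) (hAB.trans (EquivMat.mul_right B hQ)) ?_ i fun s => ?_)
    · simp [h, hrow j hj, hB, hA]
    · simpa [h, hcol i hi, hrow j hj] using hne s

end Pivot

/-! ### Extracting a normal factor -/

theorem exists_ringHom_of_normal [IsDomain R] {d : R} (hd : d ≠ 0)
    (h : ∀ r, ∃ s, d * r = s * d) : ∃ σ : R →+* R, ∀ r, d * r = σ r * d := by
  choose f hf using h
  exact ⟨{
    toFun := f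
    map_one' := mul_right_cancel₀ hd (by rw [← hf, mul_one, one_mul])
    map_mul' := fun a b => mul_right_cancel₀ hd
      (by rw [← hf, ← mul_assoc, hf, mul_assoc, hf, mul_assoc])
    map_zero' := mul_right_cancel₀ hd (by rw [← hf, mul_zero, zero_mul])
    map_add' := fun a b => mul_right_cancel₀ hd (by rw [← hf, add_mul, mul_add, hf, hf]) }, hf⟩

theorem span_eq_top_of_normal_factor [IsDomain R] {d x y : R} (hd : d ≠ 0)
    (h : ∀ r, ∃ s, r * d = d * s) (hx : x = d * y) (hmem : d ∈ TwoSidedIdeal.span {x}) :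
    TwoSidedIdeal.span {y} = ⊤ := by
  have key : ∀ z ∈ TwoSidedIdeal.span {x}, ∃ w ∈ TwoSidedIdeal.span {y}, z = d * w := by
    intro z hz
    induction hz using TwoSidedIdeal.span_induction with
    | mem z hz => exact ⟨y, TwoSidedIdeal.subset_span rfl, (Set.mem_singleton_iff.1 hz).trans hx⟩
    | zero => exact ⟨0, TwoSidedIdeal.zero_mem _, by simp⟩
    | add a b _ _ ha hb =>
      obtain ⟨u, hu, rfl⟩ := ha
      obtain ⟨v, hv, rfl⟩ := hb
      exact ⟨u + v, TwoSidedIdeal.add_mem _ hu hv, by rw [mul_add]⟩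
    | neg a _ ha =>
      obtain ⟨u, hu, rfl⟩ := ha
      exact ⟨-u, TwoSidedIdeal.neg_mem _ hu, by rw [mul_neg]⟩
    | left_absorb r a _ ha =>
      obtain ⟨u, hu, rfl⟩ := ha
      obtain ⟨s, hs⟩ := h r
      exact ⟨s * u, TwoSidedIdeal.mul_mem_left _ _ _ hu, by rw [← mul_assoc, hs, mul_assoc]⟩
    | right_absorb r a _ ha =>
      obtain ⟨u, hu, rfl⟩ := ha
      exact ⟨u * r, TwoSidedIdeal.mul_mem_right _ _ _ hu, by rw [mul_assoc]⟩
  obtain ⟨w, hw, hdw⟩ := key d hmem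
  have : w = 1 := mul_left_cancel₀ hd (by rw [← hdw, mul_one])
  rwa [← TwoSidedIdeal.one_mem_iff, ← this]

theorem EquivMat.map_mul_left {ι κ : Type*} [Fintype ι] [Fintype κ] [DecidableEq ι]
    [DecidableEq κ] {d : R} (σ : R →+* R) (hσ : ∀ r, d * r = σ r * d) {A B : Matrix ι κ R}
    (h : EquivMat A B) : EquivMat (A.map (d * ·)) (B.map (d * ·)) := by
  obtain ⟨P, Q, hP, hQ, rfl⟩ := h
  refine ⟨σ.mapMatrix P, Q, hP.map σ.mapMatrix, hQ, ?_⟩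
  ext i j
  simp only [Matrix.map_apply, Matrix.mul_apply, RingHom.mapMatrix_apply, Finset.mul_sum,
    Finset.sum_mul]
  refine Finset.sum_congr rfl fun k _ => Finset.sum_congr rfl fun l _ => ?_
  rw [← mul_assoc, ← mul_assoc, hσ]
  simp only [mul_assoc]

/-! ### Bordered matrices -/

/-- The block diagonal matrix `diag(x, B)`. -/
def bordered {m n : ℕ} (x : R) (B : Matrix (Fin m) (Fin n) R) :
    Matrix (Fin (m + 1)) (Fin (n + 1)) R :=
  Matrix.of (Fin.cons (Fin.cons x 0) fun i => Fin.cons 0 (B i))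

section Bordered

variable {l m n : ℕ} (x y : R) (B : Matrix (Fin l) (Fin m) R) (C : Matrix (Fin m) (Fin n) R)

@[simp] theorem bordered_zero_zero : bordered x B 0 0 = x := rfl

@[simp] theorem bordered_zero_succ (j : Fin m) : bordered x B 0 j.succ = 0 := rfl

@[simp] theorem bordered_succ_zero (i : Fin l) : bordered x B i.succ 0 = 0 := rfl

@[simp] theorem bordered_succ_succ (i : Fin l) (j : Fin m) :
    bordered x B i.succ j.succ = B i j := rfl

theorem bordered_mul : bordered x B * bordered y C = bordered (x * y) (B * C) := by
  ext i j
  refine Fin.cases ?_ (fun i => ?_) i <;> refine Fin.cases ?_ (fun j => ?_) j <;>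
    simp [Matrix.mul_apply, Fin.sum_univ_succ]

theorem bordered_one : bordered (1 : R) (1 : Matrix (Fin m) (Fin m) R) = 1 := by
  ext i j
  refine Fin.cases ?_ (fun i => ?_) i <;> refine Fin.cases ?_ (fun j => ?_) j <;>
    simp [Matrix.one_apply, Fin.succ_ne_zero, (Fin.succ_ne_zero _).symm]

theorem isUnit_bordered {P : Matrix (Fin m) (Fin m) R} (hP : IsUnit P) :
    IsUnit (bordered 1 P) := by
  obtain ⟨u, rfl⟩ := hP
  exact ⟨⟨bordered 1 u, bordered 1 (u⁻¹ : (Matrix (Fin m) (Fin m) R)ˣ),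
    by rw [bordered_mul, one_mul, Units.mul_inv, bordered_one],
    by rw [bordered_mul, one_mul, Units.inv_mul, bordered_one]⟩, rfl⟩

theorem EquivMat.bordered {B D : Matrix (Fin l) (Fin m) R} (h : EquivMat B D) :
    EquivMat (bordered x B) (bordered x D) := by
  obtain ⟨P, Q, hP, hQ, rfl⟩ := h
  exact ⟨_, _, isUnit_bordered hP, isUnit_bordered hQ, by simp [bordered_mul]⟩

theorem IsTotalDivisorDiag.bordered {D : Matrix (Fin l) (Fin m) R} (hD : IsTotalDivisorDiag D)
    (hx : ∀ i j, TotalDvd x (D i j)) : IsTotalDivisorDiag (bordered x D) := by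
  rw [isTotalDivisorDiag_iff] at hD ⊢
  refine ⟨fun i j => ?_, fun i j i' j' => ?_⟩
  · refine Fin.cases ?_ (fun i => ?_) i <;> refine Fin.cases ?_ (fun j => ?_) j
    · simp
    · simp
    · simp
    · intro h
      exact hD.1 i j (by simpa using h)
  · refine Fin.cases ?_ (fun i' => ?_) i' <;> refine Fin.cases ?_ (fun j' => ?_) j' <;>
      refine Fin.cases ?_ (fun i => ?_) i <;> refine Fin.cases ?_ (fun j => ?_) j <;> simp
    · intro _ _
      exact hx _ _
    · exact hD.2 i j i' j'

end Bordered

theorem IsTotalDivisorDiag.map_mul_left {m n : ℕ} {D : Matrix (Fin m) (Fin n) R}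
    (hD : IsTotalDivisorDiag D) {d : R} (h₁ : ∀ r, ∃ s, r * d = d * s)
    (h₂ : ∀ r, ∃ s, d * r = s * d) : IsTotalDivisorDiag (D.map (d * ·)) := by
  rw [isTotalDivisorDiag_iff] at hD ⊢
  exact ⟨fun i j h => by simp [hD.1 i j h],
    fun i j i' j' h h' h'' => (hD.2 i j i' j' h h' h'').smul_of_normal h₁ h₂⟩

theorem EquivMat.totalDvd {ι κ : Type*} [Fintype ι] [Fintype κ] [DecidableEq ι] [DecidableEq κ]
    {A B : Matrix ι κ R} (h : EquivMat A B) {x : R} (hA : ∀ i j, TotalDvd x (A i j)) (i : ι)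
    (j : κ) : TotalDvd x (B i j) := by
  obtain ⟨P, Q, -, -, rfl⟩ := h
  simp only [Matrix.mul_apply]
  exact TotalDvd.sum _ _ fun k _ => .mul_right _ <|
    TotalDvd.sum _ _ fun l _ => .mul_left _ (hA l k)

/-- Diagonal reduction; of the Komarnytsky and Dubrovin properties only the latter is needed. -/
theorem exists_equivMat_isTotalDivisorDiag [IsDomain R] (hB : IsBezoutRing R)
    (hS : StableRangeOne R) (hD : DProp R)
    (hfin : ∀ a : R, TwoSidedIdeal.span {a} = ⊤ → FiniteElem a) (m n : ℕ)
    (A : Matrix (Fin m) (Fin n) R) : ∃ D, EquivMat A D ∧ IsTotalDivisorDiag D := by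
  induction m generalizing n with
  | zero => exact ⟨A, .refl A, fun i => i.elim0, fun i => i.elim0⟩
  | succ m ih =>
  cases n with
  | zero => exact ⟨A, .refl A, fun _ j => j.elim0, fun _ j => j.elim0⟩
  | succ n =>
  have hr := hB.exists_add_mul hS
  have hl := hB.exists_add_mul_left hS
  obtain ⟨B, hAB, hgen⟩ := exists_generating_entry hr hl A 0 0
  obtain ⟨d, hd₁, hd₂⟩ := hD (B 0 0)
  have n₁ : ∀ r, ∃ s, r * d = d * s := fun r => (hd₂ _).2 ⟨r, rfl⟩
  have n₂ : ∀ r, ∃ s, d * r = s * d := fun r => (hd₂ _).1 ⟨r, rfl⟩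
  choose f hf using fun i j => (hd₁ _).1 (hgen i j)
  by_cases hd0 : d = 0
  · refine ⟨B, hAB, isTotalDivisorDiag_iff.2 ⟨fun i j _ => ?_, fun i j i' j' _ _ _ => ?_⟩⟩
    · rw [hf, hd0, zero_mul]
    · rw [hf i' j', hd0, zero_mul]
      exact .zero _
  let C : Matrix (Fin (m + 1)) (Fin (n + 1)) R := Matrix.of f
  have hBC : B = C.map (d * ·) := by
    ext i j
    exact hf i j
  have hC : FiniteElem (C 0 0) := hfin _ <|
    span_eq_top_of_normal_factor hd0 n₁ (hf 0 0) ((hd₁ d).2 ⟨1, (mul_one d).symm⟩)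
  obtain ⟨σ, hσ⟩ := exists_ringHom_of_normal hd0 n₂
  obtain ⟨E, hCE, hrow, hcol, hdvd⟩ := exists_pivot_totalDvd hr hl C 0 0 hC
  have hE : E = bordered (E 0 0) (E.submatrix Fin.succ Fin.succ) := by
    ext i j
    refine Fin.cases ?_ (fun i => ?_) i <;> refine Fin.cases ?_ (fun j => ?_) j
    · rfl
    · exact hrow _ (Fin.succ_ne_zero j)
    · exact hcol _ (Fin.succ_ne_zero i)
    · rfl
  obtain ⟨D, hED, hDiag⟩ := ih n (E.submatrix Fin.succ Fin.succ)
  have hCD : EquivMat C (bordered (E 0 0) D) :=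
    hCE.trans (by rw [hE]; exact hED.bordered (E 0 0))
  refine ⟨(bordered (E 0 0) D).map (d * ·),
    hAB.trans (hBC ▸ hCD.map_mul_left σ hσ), ?_⟩
  exact (hDiag.bordered _ (hED.totalDvd fun i j =>
    hdvd _ (Fin.succ_ne_zero i) _ (Fin.succ_ne_zero j))).map_mul_left n₁ n₂

end Helpers

/-- A Bézout domain of stable range 1 with the DK-property in which every
`a` with `RaR = R` is a finite element is an elementary divisor ring. -/
theorem stmt10 {R : Type*} [Ring R] [IsDomain R]
    (hB : IsBezoutRing R) (hS : StableRangeOne R) (hDK : DKProp R)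
    (hfin : ∀ a : R, TwoSidedIdeal.span {a} = ⊤ → FiniteElem a) :
    IsEDRing R := by
  intro m n A
  obtain ⟨D, ⟨P, Q, hP, hQ, rfl⟩, hD⟩ :=
    exists_equivMat_isTotalDivisorDiag hB hS hDK.1 hfin m n A
  exact ⟨P, Q, hP, hQ, hD⟩
end

section
/- Let R be a domain with the D-property such that every b ∈ R with RbR = R is a finite element. Then every nonzero element a ∈ R can be written as a = αf = φα, where α ∈ R is a duo element and f, φ ∈ R are finite elements. -/
open Matrix

/-- If `b` generates `R(bf)R` and `bR = Rb`, then cancelling `b` gives `RfR = R`. -/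
theorem IsDuoElem.span_right_factor_eq_top {R : Type*} [Ring R] [IsDomain R] {b f : R}
    (hb : IsDuoElem b) (h : b ∈ TwoSidedIdeal.span {b * f}) :
    TwoSidedIdeal.span {f} = ⊤ := by
  have key : ∀ x ∈ TwoSidedIdeal.span {b * f}, ∃ y ∈ TwoSidedIdeal.span {f}, x = b * y := by
    intro x hx
    induction hx using TwoSidedIdeal.span_induction with
    | mem x hx => exact ⟨f, TwoSidedIdeal.subset_span rfl, hx⟩
    | zero => exact ⟨0, TwoSidedIdeal.zero_mem _, by simp⟩
    | add x y _ _ hx hy =>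
      obtain ⟨u, hu, rfl⟩ := hx
      obtain ⟨v, hv, rfl⟩ := hy
      exact ⟨u + v, TwoSidedIdeal.add_mem _ hu hv, by rw [mul_add]⟩
    | neg x _ hx =>
      obtain ⟨u, hu, rfl⟩ := hx
      exact ⟨-u, TwoSidedIdeal.neg_mem _ hu, by rw [mul_neg]⟩
    | left_absorb c x _ hx =>
      obtain ⟨u, hu, rfl⟩ := hx
      obtain ⟨c', hc⟩ := (hb.2 (c * b)).2 ⟨c, rfl⟩
      exact ⟨c' * u, TwoSidedIdeal.mul_mem_left _ _ _ hu, by rw [← mul_assoc, hc, mul_assoc]⟩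
    | right_absorb c x _ hx =>
      obtain ⟨u, hu, rfl⟩ := hx
      exact ⟨u * c, TwoSidedIdeal.mul_mem_right _ _ _ hu, mul_assoc _ _ _⟩
  obtain ⟨y, hy, hby⟩ := key b h
  obtain rfl : 1 = y := mul_left_cancel₀ hb.1 (by rwa [mul_one])
  exact (TwoSidedIdeal.one_mem_iff _).1 hy

/-- If `b` generates `R(gb)R` and `bR = Rb`, then cancelling `b` gives `RgR = R`. -/
theorem IsDuoElem.span_left_factor_eq_top {R : Type*} [Ring R] [IsDomain R] {b g : R}
    (hb : IsDuoElem b) (h : b ∈ TwoSidedIdeal.span {g * b}) :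
    TwoSidedIdeal.span {g} = ⊤ := by
  have key : ∀ x ∈ TwoSidedIdeal.span {g * b}, ∃ y ∈ TwoSidedIdeal.span {g}, x = y * b := by
    intro x hx
    induction hx using TwoSidedIdeal.span_induction with
    | mem x hx => exact ⟨g, TwoSidedIdeal.subset_span rfl, hx⟩
    | zero => exact ⟨0, TwoSidedIdeal.zero_mem _, by simp⟩
    | add x y _ _ hx hy =>
      obtain ⟨u, hu, rfl⟩ := hx
      obtain ⟨v, hv, rfl⟩ := hy
      exact ⟨u + v, TwoSidedIdeal.add_mem _ hu hv, by rw [add_mul]⟩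
    | neg x _ hx =>
      obtain ⟨u, hu, rfl⟩ := hx
      exact ⟨-u, TwoSidedIdeal.neg_mem _ hu, by rw [neg_mul]⟩
    | left_absorb c x _ hx =>
      obtain ⟨u, hu, rfl⟩ := hx
      exact ⟨c * u, TwoSidedIdeal.mul_mem_left _ _ _ hu, (mul_assoc _ _ _).symm⟩
    | right_absorb c x _ hx =>
      obtain ⟨u, hu, rfl⟩ := hx
      obtain ⟨c', hc⟩ := (hb.2 (b * c)).1 ⟨c, rfl⟩
      exact ⟨u * c', TwoSidedIdeal.mul_mem_right _ _ _ hu, by rw [mul_assoc, hc, mul_assoc]⟩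
  obtain ⟨y, hy, hby⟩ := key b h
  obtain rfl : 1 = y := mul_right_cancel₀ hb.1 (by rwa [one_mul])
  exact (TwoSidedIdeal.one_mem_iff _).1 hy

/-- In a domain with the D-property in which every `b` with `RbR = R` is
finite, every nonzero `a` can be written `a = αf = φα` with `α` duo and `f, φ` finite. -/
theorem stmt11 {R : Type*} [Ring R] [IsDomain R]
    (hD : DProp R)
    (hfin : ∀ b : R, TwoSidedIdeal.span {b} = ⊤ → FiniteElem b) :
    ∀ a : R, a ≠ 0 →
      ∃ α f φ : R,
        a = α * f ∧ a = φ * α ∧ IsDuoElem α ∧ FiniteElem f ∧ FiniteElem φ := by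
  intro a ha
  obtain ⟨b, hspan, hcomm⟩ := hD a
  have hb : b ∈ TwoSidedIdeal.span {a} := (hspan b).2 ⟨1, (mul_one b).symm⟩
  obtain ⟨f, hf⟩ := (hspan a).1 (TwoSidedIdeal.subset_span rfl)
  obtain ⟨g, hg⟩ := (hcomm a).1 ⟨f, hf⟩
  have hduo : IsDuoElem b := ⟨by rintro rfl; exact ha (by simpa using hf), hcomm⟩
  exact ⟨b, f, g, hf, hg, hduo, hfin f (hduo.span_right_factor_eq_top (hf ▸ hb)),
    hfin g (hduo.span_left_factor_eq_top (hg ▸ hb))⟩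
end

section
/- Every quasi-duo elementary divisor domain of stable range 1 is a duo domain. -/
open Matrix

/-- In a quasi-duo ring, two elements generating the unit two-sided ideal generate the unit left
ideal. -/
theorem QuasiDuo.exists_left_comb_eq_one {R : Type*} [Ring R] (hQ : QuasiDuo R)
    {x y c d c' d' : R} (h : c * x * d + c' * y * d' = 1) : ∃ r s : R, r * x + s * y = 1 := by
  by_contra hne
  have htop : Ideal.span {x, y} ≠ ⊤ := fun ht =>
    hne (Ideal.mem_span_pair.1 ((Ideal.eq_top_iff_one _).1 ht))
  obtain ⟨M, hM, hle⟩ := Ideal.exists_le_maximal _ htop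
  have hx : x ∈ M := hle (Ideal.subset_span (by simp))
  have hy : y ∈ M := hle (Ideal.subset_span (by simp))
  refine hM.ne_top ((Ideal.eq_top_iff_one _).2 (h ▸ ?_))
  exact M.add_mem (hQ.1 M hM _ (M.mul_mem_left c hx) d) (hQ.1 M hM _ (M.mul_mem_left c' hy) d')

/-- In a quasi-duo elementary divisor ring, the two-sided ideal generated by `a` is contained in
`zR ∩ Rz` for some `z` of the form `p * a * q + p' * a * q'`. -/
theorem QuasiDuo.exists_span_singleton_le {R : Type*} [Ring R] (hQ : QuasiDuo R)
    (hED : IsEDRing R) (a : R) :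
    ∃ z p q p' q' : R, z = p * a * q + p' * a * q' ∧
      ∀ x ∈ TwoSidedIdeal.span {a}, (∃ r, x = z * r) ∧ ∃ s, x = s * z := by
  obtain ⟨P, Q, hP, hQu, hoff, hdiv⟩ := hED 2 2 (Matrix.diagonal fun _ => a)
  obtain ⟨P', hP'⟩ := hP.exists_right_inv
  obtain ⟨Q', hQ'⟩ := hQu.exists_right_inv
  set D := P * Matrix.diagonal (fun _ => a) * Q with hD
  have hPa : ∀ j, P 1 j * a = D 1 1 * Q' 1 j := by
    intro j
    have h : P * Matrix.diagonal (fun _ => a) = D * Q' := by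
      rw [hD, Matrix.mul_assoc, hQ', Matrix.mul_one]
    have h1 := congrFun (congrFun h 1) j
    rw [Matrix.mul_diagonal, Matrix.mul_apply, Fin.sum_univ_two, hoff 1 0 (by simp)] at h1
    simpa using h1
  have hrow : 1 * P 1 0 * P' 0 1 + 1 * P 1 1 * P' 1 1 = 1 := by
    have h := congrFun (congrFun hP' 1) 1
    simpa [Matrix.mul_apply, Fin.sum_univ_two] using h
  obtain ⟨r, s, hrs⟩ := hQ.exists_left_comb_eq_one hrow
  have ha : a ∈ TwoSidedIdeal.span {D 1 1} := by
    have hb : D 1 1 ∈ TwoSidedIdeal.span {D 1 1} := TwoSidedIdeal.subset_span rfl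
    have h : a = r * (D 1 1 * Q' 1 0) + s * (D 1 1 * Q' 1 1) := by
      rw [← hPa, ← hPa, ← mul_assoc, ← mul_assoc, ← add_mul, hrs, one_mul]
    rw [h]
    exact TwoSidedIdeal.add_mem _
      (TwoSidedIdeal.mul_mem_left _ _ _ (TwoSidedIdeal.mul_mem_right _ _ _ hb))
      (TwoSidedIdeal.mul_mem_left _ _ _ (TwoSidedIdeal.mul_mem_right _ _ _ hb))
  refine ⟨D 0 0, P 0 0, Q 0 0, P 0 1, Q 1 0, ?_, fun x hx => ?_⟩
  · simp [hD, Matrix.mul_apply, Fin.sum_univ_two]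
  · exact hdiv 0 0 1 1 rfl rfl rfl x
      (TwoSidedIdeal.span_le.2 (Set.singleton_subset_iff.2 ha) hx)

/-- Every quasi-duo elementary divisor domain of stable range 1 is a duo
domain. -/
theorem stmt13 {R : Type*} [Ring R] [IsDomain R]
    (hQ : QuasiDuo R) (hED : IsEDRing R) (hS : StableRangeOne R) :
    ∀ a x : R, (∃ r, x = a * r) ↔ ∃ s, x = s * a := by
  intro a x
  rcases eq_or_ne a 0 with rfl | ha
  · simp
  obtain ⟨z, p, q, p', q', hz, hdiv⟩ := hQ.exists_span_singleton_le hED a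
  have ha_mem : a ∈ TwoSidedIdeal.span {a} := TwoSidedIdeal.subset_span rfl
  have hz_mem : z ∈ TwoSidedIdeal.span {a} := by
    rw [hz]
    exact TwoSidedIdeal.add_mem _
      (TwoSidedIdeal.mul_mem_right _ _ _ (TwoSidedIdeal.mul_mem_left _ _ _ ha_mem))
      (TwoSidedIdeal.mul_mem_right _ _ _ (TwoSidedIdeal.mul_mem_left _ _ _ ha_mem))
  obtain ⟨⟨u, hu⟩, ⟨v, hv⟩⟩ := hdiv a ha_mem
  have hz0 : z ≠ 0 := by
    rintro rfl
    exact ha (by simpa using hu)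
  have hright : ∃ w, z = a * w := by
    obtain ⟨c, hc⟩ := (hdiv (p * z) (TwoSidedIdeal.mul_mem_left _ _ _ hz_mem)).1
    obtain ⟨c', hc'⟩ := (hdiv (p' * z) (TwoSidedIdeal.mul_mem_left _ _ _ hz_mem)).1
    have h : c * u * q + c' * u * q' = 1 := by
      apply mul_left_cancel₀ hz0
      calc z * (c * u * q + c' * u * q') = (z * c) * u * q + (z * c') * u * q' := by noncomm_ring
        _ = p * (z * u) * q + p' * (z * u) * q' := by rw [← hc, ← hc']; noncomm_ring
        _ = z * 1 := by rw [← hu, ← hz, mul_one]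
    obtain ⟨r, s, hrs⟩ := hQ.exists_left_comb_eq_one h
    rw [← add_mul] at hrs
    refine ⟨r + s, ?_⟩
    rw [hu, mul_assoc, mul_eq_one_comm.1 hrs, mul_one]
  have hleft : ∃ w, z = w * a := by
    obtain ⟨c, hc⟩ := (hdiv (z * q) (TwoSidedIdeal.mul_mem_right _ _ _ hz_mem)).2
    obtain ⟨c', hc'⟩ := (hdiv (z * q') (TwoSidedIdeal.mul_mem_right _ _ _ hz_mem)).2
    have h : p * v * c + p' * v * c' = 1 := by
      apply mul_right_cancel₀ hz0
      calc (p * v * c + p' * v * c') * z = p * v * (c * z) + p' * v * (c' * z) := by noncomm_ring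
        _ = p * (v * z) * q + p' * (v * z) * q' := by rw [← hc, ← hc']; noncomm_ring
        _ = 1 * z := by rw [← hv, ← hz, one_mul]
    obtain ⟨r, s, hrs⟩ := hQ.exists_left_comb_eq_one h
    rw [← add_mul] at hrs
    refine ⟨r + s, ?_⟩
    rw [hv, ← mul_assoc, hrs, one_mul]
  obtain ⟨w, hw⟩ := hright
  obtain ⟨w', hw'⟩ := hleft
  constructor
  · rintro ⟨r, rfl⟩
    obtain ⟨s, hs⟩ := (hdiv (a * r) (TwoSidedIdeal.mul_mem_right _ _ _ ha_mem)).2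
    exact ⟨s * w', by rw [hs, mul_assoc, ← hw']⟩
  · rintro ⟨s, rfl⟩
    obtain ⟨r, hr⟩ := (hdiv (s * a) (TwoSidedIdeal.mul_mem_left _ _ _ ha_mem)).1
    exact ⟨w * r, by rw [hr, ← mul_assoc, ← hw]⟩
end

section
/- Let R be a right Hermite ring. Then for all a, b ∈ R there exist a₀, b₀, d ∈ R such that a = d·a₀, b = d·b₀ and a₀R + b₀R = R. -/
open Matrix

/-- In a right Hermite ring, for all `a, b` there are `a₀, b₀, d` with
`a = d a₀`, `b = d b₀` and `a₀R + b₀R = R`. -/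
theorem stmt15 {R : Type*} [Ring R] [Nontrivial R] (hH : IsRightHermite R) :
    ∀ a b : R, ∃ a₀ b₀ d : R,
      a = d * a₀ ∧ b = d * b₀ ∧ ∃ x y : R, a₀ * x + b₀ * y = 1 := by
  intro a b
  obtain ⟨P, c, ⟨u, rfl⟩, hP⟩ := hH a b
  have hinv : (u : Matrix (Fin 2) (Fin 2) R) * (↑u⁻¹ : Matrix (Fin 2) (Fin 2) R) = 1 :=
    u.mul_inv
  have hinv' : (↑u⁻¹ : Matrix (Fin 2) (Fin 2) R) * (u : Matrix (Fin 2) (Fin 2) R) = 1 :=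
    u.inv_mul
  generalize (↑u⁻¹ : Matrix (Fin 2) (Fin 2) R) = Q at hinv hinv'
  have hQ : Matrix.of ![![a, b]] = Matrix.of ![![c, 0]] * Q := by
    rw [← hP, Matrix.mul_assoc, hinv, Matrix.mul_one]
  refine ⟨Q 0 0, Q 0 1, c, ?_, ?_, u.val 0 0, u.val 1 0, ?_⟩
  · simpa [Matrix.mul_apply] using congrFun (congrFun hQ 0) 0
  · simpa [Matrix.mul_apply] using congrFun (congrFun hQ 0) 1
  · simpa [Matrix.mul_apply] using congrFun (congrFun hinv' 0) 0
end
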